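/- Let T be a compactly generated triangulated category with a single compact generator G such that Hom(G, Σ^nG) = 0 for all n ≪ 0, equipped with the generating sequence 𝒢 given by 𝒢^n = {Σ^nG}. Then for every admissible subcategory A of T^c, the subcategory Coprod(A) ∩ T^b_c is a right admissible subcategory of T^b_c, where T^b_c = T̄^c ∩ 𝒢^⊥ is computed with respect to 𝒢 and the associated orthogonal metric R^𝒢. In particular, for a semiorthogonal decomposition ⟨A,B⟩ of T^c with B admissible, ⟨Coprod(A) ∩ T^b_c, Coprod(B) ∩ T^b_c⟩ is a semiorthogonal decomposition of T^b_c. -/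

import Mathlib

open CategoryTheory Limits Pretriangulated

universe v u

namespace Paper

variable (C : Type u) [Category.{v} C] [HasZeroObject C] [Preadditive C]
  [HasShift C ℤ] [∀ n : ℤ, (CategoryTheory.shiftFunctor C n).Additive] [Pretriangulated C]

variable {C}

/-- The right orthogonal of a class of objects. -/
def rOrth (S : Set C) : Set C := {X | ∀ ⦃A : C⦄, A ∈ S → ∀ f : A ⟶ X, f = 0}

/-- The left orthogonal of a class of objects. -/
def lOrth (S : Set C) : Set C := {X | ∀ ⦃A : C⦄, A ∈ S → ∀ f : X ⟶ A, f = 0}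

/-- `star S T` is the class of objects `Y` admitting a distinguished triangle
`A ⟶ Y ⟶ B ⟶ A⟦1⟧` with `A ∈ S` and `B ∈ T`. -/
def star (S T : Set C) : Set C :=
  {Y | ∃ (A B : C) (_ : A ∈ S) (_ : B ∈ T) (f : A ⟶ Y) (g : Y ⟶ B) (h : B ⟶ A⟦(1 : ℤ)⟧),
    Triangle.mk f g h ∈ distTriang C}

/-- The closure of a class of objects under finite coproducts and extensions
(equivalently, the smallest class containing `S` and all zero objects which is closed
under extensions). -/
inductive coprodClosure (S : Set C) : C → Prop
  | of {X : C} (hX : X ∈ S) : coprodClosure S X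
  | zero {X : C} (hX : IsZero X) : coprodClosure S X
  | ext {T : Triangle C} (hT : T ∈ distTriang C)
      (h₁ : coprodClosure S T.obj₁) (h₃ : coprodClosure S T.obj₃) : coprodClosure S T.obj₂

/-- The closure of a class of objects under direct summands (retracts). -/
def smd (S : Set C) : Set C :=
  {X | ∃ (Y : C) (_ : Y ∈ S) (i : X ⟶ Y) (r : Y ⟶ X), i ≫ r = 𝟙 X}

/-- The objects isomorphic to `Σ^{-i} G = G⟦-i⟧` for some `i ∈ I`. -/
def shiftSet (G : C) (I : Set ℤ) : Set C := {X | ∃ i ∈ I, Nonempty (X ≅ G⟦(-i : ℤ)⟧)}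

/-- `⟨G⟩^{I}` : summands of finite extensions of the shifts `Σ^{-i}G`, `i ∈ I`. -/
def genInt (G : C) (I : Set ℤ) : Set C := smd (setOf (coprodClosure (shiftSet G I)))

/-- The thick subcategory `⟨G⟩ = ∪_n ⟨G⟩^{[-n,n]}` generated by `G`. -/
def thickGen (G : C) : Set C := ⋃ n : ℕ, genInt G (Set.Icc (-(n : ℤ)) (n : ℤ))

/-- The closure of the union of a sequence of classes under finite coproducts, extensions
and direct summands; `𝒢^{I}` in the paper. -/
def seqInt (𝒢 : ℤ → Set C) (I : Set ℤ) : Set C :=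
  smd (setOf (coprodClosure (⋃ i ∈ I, 𝒢 i)))

section Coproducts

variable [HasCoproducts.{v} C]

/-- An object `G` is compact if every morphism from `G` to a coproduct factors through
a finite subcoproduct. -/
def IsCompactObj (G : C) : Prop :=
  ∀ ⦃α : Type v⦄ (f : α → C) (φ : G ⟶ ∐ f),
    ∃ (s : Finset α) (ψ : G ⟶ ∐ (fun i : s => f i)),
      φ = ψ ≫ Sigma.desc (fun i => Sigma.ι f i.1)

/-- The class of compact objects, `T^c`. -/
def compacts : Set C := {X | IsCompactObj X}

/-- `G` is a single compact generator of `T`. -/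
structure IsSingleCompactGenerator (G : C) : Prop where
  compact : IsCompactObj G
  generates : ∀ X : C, (∀ n : ℤ, ∀ f : G⟦n⟧ ⟶ X, f = 0) → IsZero X

/-- The closure of a class of objects under arbitrary (small) coproducts and extensions. -/
inductive bigClosure (S : Set C) : C → Prop
  | of {X : C} (hX : X ∈ S) : bigClosure S X
  | zero {X : C} (hX : IsZero X) : bigClosure S X
  | coprod {α : Type v} (f : α → C) (hf : ∀ a, bigClosure S (f a)) : bigClosure S (∐ f)
  | ext {T : Triangle C} (hT : T ∈ distTriang C)
      (h₁ : bigClosure S T.obj₁) (h₃ : bigClosure S T.obj₃) : bigClosure S T.obj₂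

/-- `Coprod(S)`, the closure of `S` under arbitrary coproducts and extensions. -/
def CoprodSet (S : Set C) : Set C := setOf (bigClosure S)

/-- `⟨G⟩̄^{I}` : summands of objects obtained from the shifts `Σ^{-i}G`, `i ∈ I`,
by arbitrary coproducts and extensions. -/
def genIntBig (G : C) (I : Set ℤ) : Set C := smd (CoprodSet (shiftSet G I))

end Coproducts

/-- A (strictly full) triangulated subcategory, as a class of objects. -/
structure IsTriangSub (S : Set C) : Prop where
  zero : ∀ X : C, IsZero X → X ∈ S
  isoClosed : ∀ {X Y : C}, (X ≅ Y) → X ∈ S → Y ∈ S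
  shift : ∀ X ∈ S, ∀ n : ℤ, X⟦n⟧ ∈ S
  ext : ∀ T ∈ distTriang C, T.obj₁ ∈ S → T.obj₃ ∈ S → T.obj₂ ∈ S

/-- The smallest strictly full triangulated subcategory containing `S`. -/
inductive triangClosure (S : Set C) : C → Prop
  | of {X : C} (hX : X ∈ S) : triangClosure S X
  | zero {X : C} (hX : IsZero X) : triangClosure S X
  | shift {X : C} (n : ℤ) (hX : triangClosure S X) : triangClosure S (X⟦n⟧)
  | ext {T : Triangle C} (hT : T ∈ distTriang C)
      (h₁ : triangClosure S T.obj₁) (h₃ : triangClosure S T.obj₃) : triangClosure S T.obj₂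

/-- A semiorthogonal decomposition `⟨A, B⟩` of the (triangulated) subcategory `D`:
`A` and `B` are strictly full triangulated subcategories of `D`, there are no nonzero
morphisms from objects of `B` to objects of `A`, and together they generate `D`. -/
structure IsSOD (D A B : Set C) : Prop where
  subsetA : A ⊆ D
  subsetB : B ⊆ D
  triangA : IsTriangSub A
  triangB : IsTriangSub B
  hom_zero : ∀ b ∈ B, ∀ a ∈ A, ∀ f : b ⟶ a, f = 0
  generates : setOf (triangClosure (A ∪ B)) = D

end Paper

namespace Paper

variable {C : Type u} [Category.{v} C] [HasZeroObject C] [Preadditive C]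
  [HasShift C ℤ] [∀ n : ℤ, (CategoryTheory.shiftFunctor C n).Additive] [Pretriangulated C]

/-- An extended good metric on a triangulated category. -/
structure IsGoodMetric (M : ℤ → Set C) : Prop where
  zero : ∀ n : ℤ, ∀ X : C, IsZero X → X ∈ M n
  isoClosed : ∀ n : ℤ, ∀ {X Y : C}, (X ≅ Y) → X ∈ M n → Y ∈ M n
  antitone : ∀ n : ℤ, M (n + 1) ⊆ M n
  extClosed : ∀ n : ℤ, star (M n) (M n) ⊆ M n
  shiftDown : ∀ n : ℤ, ∀ X ∈ M (n + 1), X⟦(-1 : ℤ)⟧ ∈ M n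
  shiftUp : ∀ n : ℤ, ∀ X ∈ M (n + 1), X⟦(1 : ℤ)⟧ ∈ M n

/-- A good metric is orthogonal if `^⊥((M_n)^⊥) = M_n` for all `n`. -/
def IsOrthogonalMetric (M : ℤ → Set C) : Prop :=
  IsGoodMetric M ∧ ∀ n : ℤ, lOrth (rOrth (M n)) = M n

section Coproducts

variable [HasCoproducts.{v} C]

/-- A generating sequence on a compactly generated triangulated category. -/
structure IsGenSeq (𝒢 : ℤ → Set C) : Prop where
  subset_compacts : ∀ n : ℤ, 𝒢 n ⊆ compacts
  generates : seqInt 𝒢 Set.univ = compacts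
  mem : ∀ n : ℤ, ∀ X ∈ 𝒢 n, X ∈ seqInt 𝒢 (Set.Icc (n - 1) (n + 1))
  shiftUp : ∀ n : ℤ, ∀ X ∈ 𝒢 n, X⟦(1 : ℤ)⟧ ∈ seqInt 𝒢 (Set.Icc (n - 1) (n + 1))
  shiftDown : ∀ n : ℤ, ∀ X ∈ 𝒢 n, X⟦(-1 : ℤ)⟧ ∈ seqInt 𝒢 (Set.Icc (n - 1) (n + 1))

/-- The closure of the compacts `T̄^c = ∩_{n∈ℤ} (T^c ⋆ R_n)` with respect to a metric `R`. -/
def closureCompacts (R : ℤ → Set C) : Set C :=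
  {F | ∀ n : ℤ, F ∈ star (compacts (C := C)) (R n)}

end Coproducts

end Paper

namespace Paper

set_option linter.unusedSectionVars false

variable {C : Type u} [Category.{v} C] [HasZeroObject C] [Preadditive C]
  [HasShift C ℤ] [∀ n : ℤ, (CategoryTheory.shiftFunctor C n).Additive] [Pretriangulated C]

/-- There is no nonzero morphism from `X` to `Y`. -/
def HomZero (X Y : C) : Prop := ∀ f : X ⟶ Y, f = 0

namespace HomZero

lemma of_retract_left {X X' Y : C} (i : X ⟶ X') (r : X' ⟶ X) (h : i ≫ r = 𝟙 X)
    (H : HomZero X' Y) : HomZero X Y := fun f => by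
  rw [← Category.id_comp f, ← h, Category.assoc, H (r ≫ f), comp_zero]

lemma of_retract_right {X Y Y' : C} (i : Y ⟶ Y') (r : Y' ⟶ Y) (h : i ≫ r = 𝟙 Y)
    (H : HomZero X Y') : HomZero X Y := fun f => by
  rw [← Category.comp_id f, ← h, ← Category.assoc, H (f ≫ i), zero_comp]

lemma of_iso_left {X X' Y : C} (e : X ≅ X') (H : HomZero X' Y) : HomZero X Y :=
  H.of_retract_left e.hom e.inv e.hom_inv_id

lemma of_iso_right {X Y Y' : C} (e : Y ≅ Y') (H : HomZero X Y') : HomZero X Y :=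
  H.of_retract_right e.hom e.inv e.hom_inv_id

lemma of_shift {X Y : C} (n : ℤ) (H : HomZero (X⟦n⟧) (Y⟦n⟧)) : HomZero X Y := fun f =>
  (CategoryTheory.shiftFunctor C n).map_injective (by rw [H (f⟦n⟧'), Functor.map_zero])

lemma shift_left {X Y : C} (n : ℤ) (H : HomZero X (Y⟦-n⟧)) : HomZero (X⟦n⟧) Y :=
  of_shift (-n) (H.of_iso_left (shiftShiftNeg X n))

lemma shift_right {X Y : C} (n : ℤ) (H : HomZero (X⟦-n⟧) Y) : HomZero X (Y⟦n⟧) :=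
  of_shift (-n) (H.of_iso_right (shiftShiftNeg Y n))

lemma of_isZero_left {X Y : C} (h : IsZero X) : HomZero X Y := fun _ => h.eq_of_src _ _

lemma of_isZero_right {X Y : C} (h : IsZero Y) : HomZero X Y := fun _ => h.eq_of_tgt _ _

lemma ext_left {T : Triangle C} (hT : T ∈ distTriang C) {Y : C}
    (h₁ : HomZero T.obj₁ Y) (h₃ : HomZero T.obj₃ Y) : HomZero T.obj₂ Y := fun f => by
  obtain ⟨g, rfl⟩ := T.yoneda_exact₂ hT f (h₁ _)
  rw [h₃ g, comp_zero]

lemma ext_right {T : Triangle C} (hT : T ∈ distTriang C) {X : C}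
    (h₁ : HomZero X T.obj₁) (h₃ : HomZero X T.obj₃) : HomZero X T.obj₂ := fun f => by
  obtain ⟨g, rfl⟩ := T.coyoneda_exact₂ hT f (h₃ _)
  rw [h₁ g, zero_comp]

end HomZero

/-- A class of objects is stable under all shifts. -/
def ShiftClosed (S : Set C) : Prop := ∀ X ∈ S, ∀ n : ℤ, X⟦n⟧ ∈ S

lemma ShiftClosed.rOrth {S : Set C} (hS : ShiftClosed S) : ShiftClosed (rOrth S) :=
  fun _ hX n A hA => HomZero.shift_right n (hX (hS A hA (-n)))

lemma IsTriangSub.shiftClosed {S : Set C} (hS : IsTriangSub S) : ShiftClosed S :=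
  hS.shift

/-- The third object of a distinguished triangle with the first two in a triangulated
subcategory. -/
lemma IsTriangSub.ext₃ {S : Set C} (hS : IsTriangSub S) {T : Triangle C}
    (hT : T ∈ distTriang C) (h₁ : T.obj₁ ∈ S) (h₂ : T.obj₂ ∈ S) : T.obj₃ ∈ S :=
  hS.ext _ (rot_of_distTriang T hT) h₂ (hS.shift _ h₁ 1)

lemma IsTriangSub.inter {S T : Set C} (hS : IsTriangSub S) (hT : IsTriangSub T) :
    IsTriangSub (S ∩ T) where
  zero X hX := ⟨hS.zero X hX, hT.zero X hX⟩
  isoClosed e hX := ⟨hS.isoClosed e hX.1, hT.isoClosed e hX.2⟩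
  shift X hX n := ⟨hS.shift X hX.1 n, hT.shift X hX.2 n⟩
  ext U hU h₁ h₃ := ⟨hS.ext U hU h₁.1 h₃.1, hT.ext U hU h₁.2 h₃.2⟩

lemma ShiftClosed.isTriangSub_rOrth {S : Set C} (hS : ShiftClosed S) :
    IsTriangSub (Paper.rOrth S) where
  zero _ hX _ _ := HomZero.of_isZero_right hX
  isoClosed e hX _ hA := HomZero.of_iso_right e.symm (hX hA)
  shift := hS.rOrth
  ext _ hU h₁ h₃ _ hA := HomZero.ext_right hU (h₁ hA) (h₃ hA)

lemma IsTriangSub.triangClosure_subset {S T : Set C} (hT : IsTriangSub T) (h : S ⊆ T)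
    {X : C} (hX : triangClosure S X) : X ∈ T := by
  induction hX with
  | of hX => exact h hX
  | zero hX => exact hT.zero _ hX
  | shift n _ ih => exact hT.shift _ ih n
  | ext hU _ _ h₁ h₃ => exact hT.ext _ hU h₁ h₃

/-- `f` induces bijections on morphisms out of the objects of `S`. -/
def CovBij (S : Set C) {X Y : C} (f : X ⟶ Y) : Prop :=
  ∀ a ∈ S, (∀ g : a ⟶ X, g ≫ f = 0 → g = 0) ∧ ∀ g : a ⟶ Y, ∃ h : a ⟶ X, h ≫ f = g

lemma CovBij.shift {S : Set C} (hS : ShiftClosed S) {X Y : C} {f : X ⟶ Y}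
    (hf : CovBij S f) (n : ℤ) : CovBij S (f⟦n⟧') := by
  intro a ha
  obtain ⟨hi, hs⟩ := hf _ (hS a ha (-n))
  let e : a⟦-n⟧⟦n⟧ ≅ a := shiftNegShift a n
  constructor
  · intro g hg
    obtain ⟨k, hk⟩ := (CategoryTheory.shiftFunctor C n).map_surjective (e.hom ≫ g)
    have hk0 : k = 0 := hi k ((CategoryTheory.shiftFunctor C n).map_injective (by
      rw [Functor.map_comp, hk, Category.assoc, hg, comp_zero, Functor.map_zero]))
    rw [hk0, Functor.map_zero] at hk
    exact (cancel_epi e.hom).1 (by rw [← hk, comp_zero])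
  · intro g
    obtain ⟨k, hk⟩ := (CategoryTheory.shiftFunctor C n).map_surjective (e.hom ≫ g)
    obtain ⟨h, rfl⟩ := hs k
    refine ⟨e.inv ≫ h⟦n⟧', ?_⟩
    rw [Category.assoc, ← Functor.map_comp, hk, e.inv_hom_id_assoc]

lemma CovBij.hom₃ {S : Set C} (hS : ShiftClosed S) {T T' : Triangle C}
    (hT : T ∈ distTriang C) (hT' : T' ∈ distTriang C) (φ : T ⟶ T')
    (h₁ : CovBij S φ.hom₁) (h₂ : CovBij S φ.hom₂) : CovBij S φ.hom₃ := by
  intro a ha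
  have h₁' := h₁.shift hS 1 a ha
  have h₂' := h₂.shift hS 1 a ha
  have c₁ := φ.comm₁
  have c₂ := φ.comm₂
  have c₃ := φ.comm₃
  constructor
  · intro g hg
    have e : g ≫ T.mor₃ = 0 := h₁'.1 _ (by rw [Category.assoc, c₃, reassoc_of% hg, zero_comp])
    obtain ⟨h, rfl⟩ := T.coyoneda_exact₃ hT g e
    obtain ⟨l, hl⟩ := T'.coyoneda_exact₂ hT' (h ≫ φ.hom₂)
      (by rw [Category.assoc, ← c₂, ← Category.assoc, hg])
    obtain ⟨l', rfl⟩ := (h₁ a ha).2 l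
    have : h - l' ≫ T.mor₁ = 0 := (h₂ a ha).1 _ (by
      rw [Preadditive.sub_comp, hl, Category.assoc, Category.assoc, c₁, sub_self])
    rw [sub_eq_zero.1 this, Category.assoc, comp_distTriang_mor_zero₁₂ _ hT, comp_zero]
  · intro g
    obtain ⟨h, hh⟩ := h₁'.2 (g ≫ T'.mor₃)
    have e : h ≫ T.mor₁⟦1⟧' = 0 := h₂'.1 _ (by
      rw [Category.assoc, ← Functor.map_comp, c₁, Functor.map_comp, reassoc_of% hh,
        comp_distTriang_mor_zero₃₁ _ hT', comp_zero])
    obtain ⟨k, rfl⟩ := T.coyoneda_exact₁ hT h e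
    obtain ⟨l, hl⟩ := T'.coyoneda_exact₃ hT' (g - k ≫ φ.hom₃) (by
      rw [Preadditive.sub_comp, ← hh, Category.assoc, Category.assoc, c₃, sub_self])
    obtain ⟨l', rfl⟩ := (h₂ a ha).2 l
    refine ⟨k + l' ≫ T.mor₂, ?_⟩
    rw [Preadditive.add_comp, Category.assoc, c₂, ← Category.assoc l', ← hl]
    abel

lemma CovBij.hom₂ {S : Set C} (hS : ShiftClosed S) {T T' : Triangle C}
    (hT : T ∈ distTriang C) (hT' : T' ∈ distTriang C) (φ : T ⟶ T')
    (h₁ : CovBij S φ.hom₁) (h₃ : CovBij S φ.hom₃) : CovBij S φ.hom₂ :=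
  CovBij.hom₃ hS (inv_rot_of_distTriang _ hT) (inv_rot_of_distTriang _ hT')
    ((invRotate C).map φ) (h₃.shift hS (-1)) h₁

lemma CovBij.rOrth_of_distTriang {S : Set C} (hS : ShiftClosed S) {T : Triangle C}
    (hT : T ∈ distTriang C) (h : CovBij S T.mor₁) : T.obj₃ ∈ rOrth S := by
  intro a ha g
  have e : g ≫ T.mor₃ = 0 := (h.shift hS 1 a ha).1 _ (by
    rw [Category.assoc, comp_distTriang_mor_zero₃₁ _ hT, comp_zero])
  obtain ⟨k, rfl⟩ := T.coyoneda_exact₃ hT g e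
  obtain ⟨l, rfl⟩ := (h a ha).2 k
  rw [Category.assoc, comp_distTriang_mor_zero₁₂ _ hT, comp_zero]

lemma covBij_of_distTriang {S : Set C} (hS : ShiftClosed S) {T : Triangle C}
    (hT : T ∈ distTriang C) (h : T.obj₃ ∈ rOrth S) : CovBij S T.mor₁ := by
  intro a ha
  constructor
  · intro g hg
    apply (CategoryTheory.shiftFunctor C (1 : ℤ)).map_injective
    obtain ⟨k, hk⟩ := T.coyoneda_exact₁ hT (g⟦(1 : ℤ)⟧')
      (by rw [← Functor.map_comp, hg, Functor.map_zero])
    rw [hk, h (hS a ha 1) k, zero_comp, Functor.map_zero]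
  · intro g
    obtain ⟨k, hk⟩ := T.coyoneda_exact₂ hT g (h ha _)
    exact ⟨k, hk.symm⟩

lemma covBij_zero_of_isZero {S : Set C} {X Y : C} (hX : IsZero X) (hY : Y ∈ rOrth S) :
    CovBij S (0 : X ⟶ Y) := fun _ ha =>
  ⟨fun _ _ => hX.eq_of_tgt _ _, fun g => ⟨0, by rw [hY ha g, comp_zero]⟩⟩

lemma covBij_id (S : Set C) (X : C) : CovBij S (𝟙 X) := fun _ _ =>
  ⟨fun g hg => by simpa using hg, fun g => ⟨g, by simp⟩⟩

/-- Precomposition with `f` is injective on morphisms to `d`. -/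
def ContraInj {X Y : C} (f : X ⟶ Y) (d : C) : Prop := ∀ g : Y ⟶ d, f ≫ g = 0 → g = 0

/-- Precomposition with `f` is surjective on morphisms to `d`. -/
def ContraSurj {X Y : C} (f : X ⟶ Y) (d : C) : Prop :=
  ∀ g : X ⟶ d, ∃ h : Y ⟶ d, f ≫ h = g

lemma ContraInj.hom₂ {T T' : Triangle C} (hT : T ∈ distTriang C) (hT' : T' ∈ distTriang C)
    (φ : T ⟶ T') {d : C} (h₁ : ContraInj φ.hom₁ d) (h₃ : ContraInj φ.hom₃ d)
    (h₁' : ContraSurj (φ.hom₁⟦(1 : ℤ)⟧') d) : ContraInj φ.hom₂ d := by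
  have c₁ := φ.comm₁
  have c₂ := φ.comm₂
  have c₃ := φ.comm₃
  intro g hg
  obtain ⟨h, rfl⟩ := T'.yoneda_exact₂ hT' g
    (h₁ _ (by rw [← Category.assoc, ← c₁, Category.assoc, hg, comp_zero]))
  obtain ⟨k, hk⟩ := T.yoneda_exact₃ hT (φ.hom₃ ≫ h) (by rw [← Category.assoc, c₂, Category.assoc, hg])
  obtain ⟨k', rfl⟩ := h₁' k
  have : h - T'.mor₃ ≫ k' = 0 := h₃ _ (by
    rw [Preadditive.comp_sub, hk, ← Category.assoc, ← Category.assoc, c₃, sub_self])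
  rw [sub_eq_zero.1 this, ← Category.assoc, comp_distTriang_mor_zero₂₃ _ hT', zero_comp]

lemma ContraSurj.hom₃ {T T' : Triangle C} (hT : T ∈ distTriang C) (hT' : T' ∈ distTriang C)
    (φ : T ⟶ T') {d : C} (h₁ : ContraInj φ.hom₁ d) (h₂ : ContraSurj φ.hom₂ d)
    (h₁' : ContraSurj (φ.hom₁⟦(1 : ℤ)⟧') d) : ContraSurj φ.hom₃ d := by
  have c₁ := φ.comm₁
  have c₂ := φ.comm₂
  have c₃ := φ.comm₃
  intro g
  obtain ⟨h, hh⟩ := h₂ (T.mor₂ ≫ g)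
  obtain ⟨k, rfl⟩ := T'.yoneda_exact₂ hT' h (h₁ _ (by
    rw [← Category.assoc, ← c₁, Category.assoc, hh, ← Category.assoc,
      comp_distTriang_mor_zero₁₂ _ hT, zero_comp]))
  obtain ⟨l, hl⟩ := T.yoneda_exact₃ hT (g - φ.hom₃ ≫ k) (by
    rw [Preadditive.comp_sub, ← hh, ← Category.assoc, ← Category.assoc, c₂, sub_self])
  obtain ⟨l', rfl⟩ := h₁' l
  refine ⟨k + T'.mor₃ ≫ l', ?_⟩
  rw [Preadditive.comp_add, ← Category.assoc φ.hom₃ T'.mor₃, ← c₃, Category.assoc, ← hl]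
  abel

lemma ContraSurj.shift_hom₂ {T T' : Triangle C} (hT : T ∈ distTriang C)
    (hT' : T' ∈ distTriang C) (φ : T ⟶ T') {d : C} (h₃ : ContraInj φ.hom₃ d)
    (h₁ : ContraSurj (φ.hom₁⟦(1 : ℤ)⟧') d) (h₃' : ContraSurj (φ.hom₃⟦(1 : ℤ)⟧') d) :
    ContraSurj (φ.hom₂⟦(1 : ℤ)⟧') d :=
  ContraSurj.hom₃ (rot_of_distTriang _ (rot_of_distTriang _ hT))
    (rot_of_distTriang _ (rot_of_distTriang _ hT')) ((rotate C).map ((rotate C).map φ)) h₃ h₁ h₃'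

lemma contraInj_of_distTriang {T : Triangle C} (hT : T ∈ distTriang C) {d : C}
    (h : HomZero T.obj₃ d) : ContraInj T.mor₁ d := fun g hg => by
  obtain ⟨k, rfl⟩ := T.yoneda_exact₂ hT g hg
  rw [h k, comp_zero]

lemma contraSurj_shift_of_distTriang {T : Triangle C} (hT : T ∈ distTriang C) {d : C}
    (h : HomZero T.obj₃ d) : ContraSurj (T.mor₁⟦(1 : ℤ)⟧') d := fun g => by
  obtain ⟨k, hk⟩ : ∃ k : T.obj₂⟦(1 : ℤ)⟧ ⟶ d, g = (-T.mor₁⟦(1 : ℤ)⟧') ≫ k :=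
    Triangle.yoneda_exact₂ _ (rot_of_distTriang _ (rot_of_distTriang _ hT)) g (h _)
  exact ⟨-k, by simp [hk]⟩

lemma homZero_of_distTriang {T : Triangle C} (hT : T ∈ distTriang C) {d : C}
    (h : ContraInj T.mor₁ d) (h' : ContraSurj (T.mor₁⟦(1 : ℤ)⟧') d) : HomZero T.obj₃ d := by
  intro g
  obtain ⟨k, rfl⟩ := T.yoneda_exact₃ hT g
    (h _ (by rw [← Category.assoc, comp_distTriang_mor_zero₁₂ _ hT, zero_comp]))
  obtain ⟨l, rfl⟩ := h' k
  rw [← Category.assoc, comp_distTriang_mor_zero₃₁ _ hT, zero_comp]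

/-- `f` induces bijections on morphisms to the objects of `S`. -/
def ContraBij (S : Set C) {X Y : C} (f : X ⟶ Y) : Prop :=
  ∀ d ∈ S, ContraInj f d ∧ ContraSurj f d

lemma ContraBij.shift {S : Set C} (hS : ShiftClosed S) {X Y : C} {f : X ⟶ Y}
    (hf : ContraBij S f) (n : ℤ) : ContraBij S (f⟦n⟧') := by
  intro d hd
  obtain ⟨hi, hs⟩ := hf _ (hS d hd (-n))
  let e : d⟦-n⟧⟦n⟧ ≅ d := shiftNegShift d n
  constructor
  · intro g hg
    obtain ⟨k, hk⟩ := (CategoryTheory.shiftFunctor C n).map_surjective (g ≫ e.inv)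
    have hk0 : k = 0 := hi k ((CategoryTheory.shiftFunctor C n).map_injective (by
      rw [Functor.map_comp, hk, ← Category.assoc, hg, zero_comp, Functor.map_zero]))
    rw [hk0, Functor.map_zero] at hk
    exact (cancel_mono e.inv).1 (by rw [← hk, zero_comp])
  · intro g
    obtain ⟨k, hk⟩ := (CategoryTheory.shiftFunctor C n).map_surjective (g ≫ e.inv)
    obtain ⟨h, rfl⟩ := hs k
    refine ⟨h⟦n⟧' ≫ e.hom, ?_⟩
    rw [← Category.assoc, ← Functor.map_comp, hk, Category.assoc, e.inv_hom_id, Category.comp_id]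

lemma ContraBij.hom₂ {S : Set C} (hS : ShiftClosed S) {T T' : Triangle C}
    (hT : T ∈ distTriang C) (hT' : T' ∈ distTriang C) (φ : T ⟶ T')
    (h₁ : ContraBij S φ.hom₁) (h₃ : ContraBij S φ.hom₃) : ContraBij S φ.hom₂ := by
  have h : ∀ d ∈ S, ContraSurj (φ.hom₂⟦(1 : ℤ)⟧') d := fun d hd =>
    ContraSurj.shift_hom₂ hT hT' φ (h₃ d hd).1 (h₁.shift hS 1 d hd).2 (h₃.shift hS 1 d hd).2
  intro d hd
  refine ⟨ContraInj.hom₂ hT hT' φ (h₁ d hd).1 (h₃ d hd).1 (h₁.shift hS 1 d hd).2, fun g => ?_⟩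
  obtain ⟨k, hk⟩ := h _ (hS d hd 1) (g⟦(1 : ℤ)⟧')
  refine ⟨(CategoryTheory.shiftFunctor C (1 : ℤ)).preimage k, ?_⟩
  apply (CategoryTheory.shiftFunctor C (1 : ℤ)).map_injective
  rw [Functor.map_comp, Functor.map_preimage, hk]

lemma contraBij_zero_of_isZero {S : Set C} {X Y : C} (hY : IsZero Y) (hX : X ∈ lOrth S) :
    ContraBij S (0 : X ⟶ Y) := fun _ hd =>
  ⟨fun _ _ => hY.eq_of_src _ _, fun g => ⟨0, by rw [hX hd g, comp_zero]⟩⟩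

lemma contraBij_id (S : Set C) (X : C) : ContraBij S (𝟙 X) := fun _ _ =>
  ⟨fun g hg => by simpa using hg, fun g => ⟨g, by simp⟩⟩

/-- The completion of a commutative square to a morphism of distinguished triangles
between given cones. -/
lemma exists_triangle_hom {T T' : Triangle C} (hT : T ∈ distTriang C) (hT' : T' ∈ distTriang C)
    (a : T.obj₁ ⟶ T'.obj₁) (b : T.obj₂ ⟶ T'.obj₂) (h : T.mor₁ ≫ b = a ≫ T'.mor₁) :
    ∃ φ : T ⟶ T', φ.hom₁ = a ∧ φ.hom₂ = b := by
  obtain ⟨c, h₂, h₃⟩ := complete_distinguished_triangle_morphism T T' hT hT' a b h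
  exact ⟨{ hom₁ := a, hom₂ := b, hom₃ := c, comm₁ := h, comm₂ := h₂, comm₃ := h₃ }, rfl, rfl⟩

lemma exists_triangle_hom₂ {T T' : Triangle C} (hT : T ∈ distTriang C)
    (hT' : T' ∈ distTriang C) (a : T.obj₁ ⟶ T'.obj₁) (c : T.obj₃ ⟶ T'.obj₃)
    (h : T.mor₃ ≫ a⟦(1 : ℤ)⟧' = c ≫ T'.mor₃) :
    ∃ φ : T ⟶ T', φ.hom₁ = a ∧ φ.hom₃ = c := by
  obtain ⟨b, h₁, h₂⟩ := complete_distinguished_triangle_morphism₂ T T' hT hT' a c h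
  exact ⟨{ hom₁ := a, hom₂ := b, hom₃ := c, comm₁ := h₁, comm₂ := h₂, comm₃ := h }, rfl, rfl⟩

section Compact

open scoped Classical ZeroObject

variable [HasCoproducts.{v} C]

lemma isCompactObj_iff {G : C} : IsCompactObj G ↔ ∀ ⦃α : Type v⦄ (f : α → C) (φ : G ⟶ ∐ f),
    ∃ s : Finset α, φ = ∑ i ∈ s, (φ ≫ Sigma.π f i) ≫ Sigma.ι f i := by
  constructor
  · intro h α f φ
    obtain ⟨s, ψ, rfl⟩ := h f φ
    refine ⟨s, ?_⟩
    rw [← Finset.sum_coe_sort s]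
    simp only [Category.assoc]
    rw [← Preadditive.comp_sum]
    congr 1
    ext j
    rw [Preadditive.comp_sum, Finset.sum_eq_single j]
    · simp [Sigma.ι_π_eq_id_assoc]
    · intro b _ hb
      have : (j : α) ≠ b := fun h => hb (Subtype.ext h.symm)
      simp [reassoc_of% Sigma.ι_π_of_ne f this]
    · simp
  · intro h α f φ
    obtain ⟨s, hs⟩ := h f φ
    refine ⟨s, ∑ i : s, (φ ≫ Sigma.π f i) ≫ Sigma.ι (fun i : s => f i) i, ?_⟩
    rw [Preadditive.sum_comp]
    conv_lhs => rw [hs, ← Finset.sum_coe_sort s]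
    simp

lemma IsCompactObj.eq_of_π {G : C} (hG : IsCompactObj G) {α : Type v} {f : α → C}
    {φ : G ⟶ ∐ f} (h : ∀ i, φ ≫ Sigma.π f i = 0) : φ = 0 := by
  obtain ⟨s, hs⟩ := isCompactObj_iff.1 hG f φ
  rw [hs]
  exact Finset.sum_eq_zero fun i _ => by rw [h, zero_comp]

lemma isCompactObj_of_sum {G : C} (h : ∀ ⦃α : Type v⦄ (f : α → C) (φ : G ⟶ ∐ f),
    ∃ (s : Finset α) (ψ : ∀ i, G ⟶ f i), φ = ∑ i ∈ s, ψ i ≫ Sigma.ι f i) :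
    IsCompactObj G := by
  intro α f φ
  obtain ⟨s, ψ, hs⟩ := h f φ
  refine ⟨s, ∑ i : s, ψ i ≫ Sigma.ι (fun i : s => f i) i, ?_⟩
  rw [Preadditive.sum_comp]
  conv_lhs => rw [hs, ← Finset.sum_coe_sort s]
  simp

lemma IsCompactObj.of_retract {X Y : C} (i : X ⟶ Y) (r : Y ⟶ X) (h : i ≫ r = 𝟙 X)
    (hY : IsCompactObj Y) : IsCompactObj X := by
  intro α f φ
  obtain ⟨s, ψ, hψ⟩ := hY f (r ≫ φ)
  exact ⟨s, i ≫ ψ, by rw [Category.assoc, ← hψ, ← Category.assoc, h, Category.id_comp]⟩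

lemma IsCompactObj.shift {X : C} (hX : IsCompactObj X) (n : ℤ) : IsCompactObj (X⟦n⟧) := by
  apply isCompactObj_of_sum
  intro α f φ
  let F := CategoryTheory.shiftFunctor C n
  let f' : α → C := fun i => (f i)⟦-n⟧
  let e : ∐ f ≅ (∐ f')⟦n⟧ := by
    refine (Sigma.mapIso fun i => (shiftNegShift (f i) n).symm) ≪≫ (PreservesCoproduct.iso F f').symm
  have he : ∀ i, Sigma.ι f i ≫ e.hom = (shiftNegShift (f i) n).inv ≫ F.map (Sigma.ι f' i) := by
    intro i
    simp only [e, Iso.trans_hom, Iso.symm_hom, PreservesCoproduct.inv_hom]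
    rw [← ι_comp_sigmaComparison, Sigma.ι_mapIso_hom_assoc]
    rfl
  obtain ⟨ψ, hψ⟩ := F.map_surjective (φ ≫ e.hom)
  obtain ⟨s, hs⟩ := isCompactObj_iff.1 hX f' ψ
  refine ⟨s, fun i => F.map (ψ ≫ Sigma.π f' i) ≫ (shiftNegShift (f i) n).hom, ?_⟩
  rw [← cancel_mono e.hom, ← hψ, Preadditive.sum_comp]
  conv_lhs => rw [hs, Functor.map_sum]
  refine Finset.sum_congr rfl fun i _ => ?_
  have h : ∀ {Z : C} (x : X⟦n⟧ ⟶ (f' i)⟦n⟧) (y : (f' i)⟦n⟧ ⟶ Z),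
      (x ≫ (shiftNegShift (f i) n).hom) ≫ (shiftNegShift (f i) n).inv ≫ y = x ≫ y :=
    fun x y => (Category.assoc _ _ _).trans
      (congrArg (x ≫ ·) ((shiftNegShift (f i) n).hom_inv_id_assoc y))
  rw [Category.assoc (F.map _ ≫ _), he, h, Functor.map_comp]

lemma IsCompactObj.of_isZero {X : C} (hX : IsZero X) : IsCompactObj X :=
  fun _ _ _ => ⟨∅, 0, hX.eq_of_src _ _⟩

lemma IsCompactObj.ext {T : Triangle C} (hT : T ∈ distTriang C) (h₁ : IsCompactObj T.obj₁)
    (h₃ : IsCompactObj T.obj₃) : IsCompactObj T.obj₂ := by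
  rw [isCompactObj_iff]
  intro α f φ
  let e : Finset α → (∐ f ⟶ ∐ f) := fun s => ∑ i ∈ s, Sigma.π f i ≫ Sigma.ι f i
  have he : ∀ s {X : C} (φ : X ⟶ ∐ f), φ ≫ e s = ∑ i ∈ s, (φ ≫ Sigma.π f i) ≫ Sigma.ι f i := by
    intro s X φ
    simp [e, Preadditive.comp_sum]
  have hee : ∀ s t, s ⊆ t → e s ≫ e t = e s := by
    intro s t hst
    simp only [e, Preadditive.sum_comp]
    refine Finset.sum_congr rfl fun i hi => ?_
    rw [Preadditive.comp_sum, Finset.sum_eq_single_of_mem i (hst hi)]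
    · simp [Sigma.ι_π_eq_id_assoc]
    · intro j _ hj
      simp [reassoc_of% Sigma.ι_π_of_ne f hj.symm]
  obtain ⟨s, hs⟩ := isCompactObj_iff.1 h₁ f (T.mor₁ ≫ φ)
  rw [← he] at hs
  obtain ⟨χ, hχ⟩ := T.yoneda_exact₂ hT (φ - φ ≫ e s) (by
    rw [Preadditive.comp_sub, ← Category.assoc, ← hs, sub_self])
  obtain ⟨t, ht⟩ := isCompactObj_iff.1 h₃ f χ
  rw [← he] at ht
  refine ⟨s ∪ t, ?_⟩
  rw [← he]
  have e₁ := hee s (s ∪ t) Finset.subset_union_left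
  have e₂ : χ ≫ e (s ∪ t) = χ := by
    rw [ht, Category.assoc, hee t (s ∪ t) Finset.subset_union_right]
  have e₃ : φ = φ ≫ e s + T.mor₂ ≫ χ := by rw [← hχ]; abel
  conv_rhs => rw [e₃, Preadditive.add_comp, Category.assoc, Category.assoc, e₁, e₂]
  exact e₃

lemma isTriangSub_compacts : IsTriangSub (compacts (C := C)) where
  zero _ hX := IsCompactObj.of_isZero hX
  isoClosed e hX := IsCompactObj.of_retract e.inv e.hom e.inv_hom_id hX
  shift _ hX n := IsCompactObj.shift hX n
  ext _ hT h₁ h₃ := IsCompactObj.ext hT h₁ h₃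

lemma HomZero.coprod_right {P : C} (hP : IsCompactObj P) {α : Type v} {f : α → C}
    (h : ∀ i, HomZero P (f i)) : HomZero P (∐ f) := fun _ =>
  hP.eq_of_π fun i => h i _

lemma HomZero.coprod_left {Y : C} {α : Type v} {f : α → C}
    (h : ∀ i, HomZero (f i) Y) : HomZero (∐ f) Y := fun g => by
  refine Sigma.hom_ext _ _ fun i => ?_
  rw [h i (Sigma.ι f i ≫ g), comp_zero]

lemma bigClosure.of_iso {S : Set C} {X Y : C} (e : X ≅ Y) (hX : bigClosure S X) :
    bigClosure S Y :=
  bigClosure.ext (T := Triangle.mk e.hom (0 : Y ⟶ 0) 0)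
    ((Triangle.distinguished_iff_of_isZero₃ _ (isZero_zero C)).2 (inferInstanceAs (IsIso e.hom)))
    hX (.zero (isZero_zero C))

lemma bigClosure.trans {S S' : Set C} (h : ∀ X ∈ S, bigClosure S' X) {X : C}
    (hX : bigClosure S X) : bigClosure S' X := by
  induction hX with
  | of hX => exact h _ hX
  | zero hX => exact .zero hX
  | coprod f _ ih => exact .coprod f ih
  | ext hT _ _ h₁ h₃ => exact .ext hT h₁ h₃

lemma bigClosure.shift {S S' : Set C} (n : ℤ) (h : ∀ X ∈ S, bigClosure S' (X⟦n⟧)) {X : C}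
    (hX : bigClosure S X) : bigClosure S' (X⟦n⟧) := by
  induction hX with
  | of hX => exact h _ hX
  | zero hX => exact .zero ((CategoryTheory.shiftFunctor C n).map_isZero hX)
  | coprod f _ ih =>
    exact .of_iso (PreservesCoproduct.iso (CategoryTheory.shiftFunctor C n) f).symm (.coprod _ ih)
  | ext hT _ _ h₁ h₃ => exact .ext (Triangle.shift_distinguished _ hT n) h₁ h₃

lemma bigClosure.homZero_right {S : Set C} {P : C} (hP : IsCompactObj P)
    (h : ∀ X ∈ S, HomZero P X) {X : C} (hX : bigClosure S X) : HomZero P X := by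
  induction hX with
  | of hX => exact h _ hX
  | zero hX => exact .of_isZero_right hX
  | coprod f _ ih => exact .coprod_right hP ih
  | ext hT _ _ h₁ h₃ => exact .ext_right hT h₁ h₃

lemma bigClosure.homZero_left {S : Set C} {Y : C}
    (h : ∀ X ∈ S, HomZero X Y) {X : C} (hX : bigClosure S X) : HomZero X Y := by
  induction hX with
  | of hX => exact h _ hX
  | zero hX => exact .of_isZero_left hX
  | coprod f _ ih => exact .coprod_left ih
  | ext hT _ _ h₁ h₃ => exact .ext_left hT h₁ h₃

lemma CoprodSet.isTriangSub {S : Set C} (hS : ShiftClosed S) : IsTriangSub (CoprodSet S) where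
  zero _ hX := .zero hX
  isoClosed e hX := .of_iso e hX
  shift _ hX n := bigClosure.shift n (fun X h => .of (hS X h n)) hX
  ext _ hT h₁ h₃ := .ext hT h₁ h₃

lemma rOrth_CoprodSet {S : Set C} : rOrth (CoprodSet S) = rOrth S := by
  ext X
  exact ⟨fun h A hA => h (.of hA), fun h A hA => bigClosure.homZero_left h hA⟩

lemma CovBij.coprodSet {S : Set C} (hS : ShiftClosed S) {X Y : C} {f : X ⟶ Y}
    (hf : CovBij S f) : CovBij (CoprodSet S) f := by
  obtain ⟨Z, g, h, hT⟩ := distinguished_cocone_triangle f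
  refine covBij_of_distTriang (CoprodSet.isTriangSub hS).shiftClosed hT ?_
  rw [rOrth_CoprodSet]
  exact CovBij.rOrth_of_distTriang hS hT hf

lemma CovBij.sigmaMap {S : Set C} (hS : S ⊆ compacts) {α : Type v} {X Y : α → C}
    {f : ∀ i, X i ⟶ Y i} (hf : ∀ i, CovBij S (f i)) : CovBij S (Limits.Sigma.map f) := by
  have hπ : ∀ i, Limits.Sigma.map f ≫ Sigma.π Y i = Sigma.π X i ≫ f i := by
    intro i
    ext j
    by_cases h : j = i
    · subst h
      simp [Sigma.ι_π_eq_id_assoc, Sigma.ι_π_eq_id]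
    · simp [Sigma.ι_π_of_ne _ h, reassoc_of% Sigma.ι_π_of_ne X h]
  intro a ha
  constructor
  · intro g hg
    refine IsCompactObj.eq_of_π (hS ha) fun i => (hf i a ha).1 _ ?_
    rw [Category.assoc, ← hπ, reassoc_of% hg, zero_comp]
  · intro g
    obtain ⟨s, hs⟩ := isCompactObj_iff.1 (hS ha) Y g
    choose l hl using fun i => (hf i a ha).2 (g ≫ Sigma.π Y i)
    refine ⟨∑ i ∈ s, l i ≫ Sigma.ι X i, ?_⟩
    rw [Preadditive.sum_comp]
    conv_rhs => rw [hs]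
    exact Finset.sum_congr rfl fun i _ => by simp [← hl]

lemma mem_lOrth_of_distTriang {S : Set C} {T : Triangle C} (hT : T ∈ distTriang C)
    (h₁ : T.obj₁ ∈ lOrth S) (h₃ : T.obj₃ ∈ lOrth S) : T.obj₂ ∈ lOrth S :=
  fun _ hA => HomZero.ext_left hT (h₁ hA) (h₃ hA)

/-- The morphism `φ` factors through a finite extension of objects of `S`. -/
def FactorsFinitely (S : Set C) {P Y : C} (φ : P ⟶ Y) : Prop :=
  ∃ (Q : C) (_ : coprodClosure S Q) (a : P ⟶ Q) (b : Q ⟶ Y), a ≫ b = φ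

lemma FactorsFinitely.zero (S : Set C) (P Y : C) : FactorsFinitely S (0 : P ⟶ Y) :=
  ⟨0, .zero (isZero_zero C), 0, 0, by simp⟩

lemma FactorsFinitely.add {S : Set C} {P Y : C} {φ ψ : P ⟶ Y} (hφ : FactorsFinitely S φ)
    (hψ : FactorsFinitely S ψ) : FactorsFinitely S (φ + ψ) := by
  obtain ⟨Q, hQ, a, b, rfl⟩ := hφ
  obtain ⟨Q', hQ', a', b', rfl⟩ := hψ
  exact ⟨Q ⊞ Q', .ext (binaryBiproductTriangle_distinguished Q Q') hQ hQ',
    biprod.lift a a', biprod.desc b b', by simp⟩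

lemma FactorsFinitely.sum {S : Set C} {P Y : C} {α : Type*} (s : Finset α) {φ : α → (P ⟶ Y)}
    (h : ∀ i, FactorsFinitely S (φ i)) : FactorsFinitely S (∑ i ∈ s, φ i) := by
  induction s using Finset.induction_on with
  | empty => simpa using FactorsFinitely.zero S P Y
  | insert i s hi ih => rw [Finset.sum_insert hi]; exact (h i).add ih

lemma FactorsFinitely.comp {S : Set C} {P Y Z : C} {φ : P ⟶ Y} (h : FactorsFinitely S φ)
    (g : Y ⟶ Z) : FactorsFinitely S (φ ≫ g) := by
  obtain ⟨Q, hQ, a, b, rfl⟩ := h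
  exact ⟨Q, hQ, a, b ≫ g, by simp⟩

lemma coprodClosure.isCompactObj {S : Set C} (hS : S ⊆ compacts) {X : C}
    (hX : coprodClosure S X) : IsCompactObj X := by
  induction hX with
  | of hX => exact hS hX
  | zero hX => exact .of_isZero hX
  | ext hT _ _ h₁ h₃ => exact .ext hT h₁ h₃

/-- A morphism from a compact object to an object built from compact objects of `S` by
coproducts and extensions factors through a finite extension of objects of `S`. -/
lemma bigClosure.factorsFinitely {S : Set C} (hS : S ⊆ compacts) {Y : C}
    (hY : bigClosure S Y) : ∀ {P : C}, IsCompactObj P → ∀ φ : P ⟶ Y, FactorsFinitely S φ := by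
  induction hY with
  | of hX => exact fun _ φ => ⟨_, .of hX, φ, 𝟙 _, by simp⟩
  | zero hX => exact fun _ φ => ⟨_, .zero hX, φ, 𝟙 _, by simp⟩
  | coprod f _ ih =>
    intro P hP φ
    obtain ⟨s, hs⟩ := isCompactObj_iff.1 hP f φ
    rw [hs]
    exact FactorsFinitely.sum s fun i => (ih i hP _).comp _
  | @ext T hT _ _ ih₁ ih₃ =>
    intro P hP φ
    obtain ⟨Q₃, hQ₃, a, b, hab⟩ := ih₃ hP (φ ≫ T.mor₂)
    have hQ₃c := hQ₃.isCompactObj hS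
    let sh := CategoryTheory.shiftFunctor C (1 : ℤ)
    -- a finite object `Q₁` with a compatible map `Q₃ ⟶ Q₁⟦1⟧`
    obtain ⟨Q₁, hQ₁, c, d, hcd⟩ : ∃ (Q₁ : C) (_ : coprodClosure S Q₁) (c : Q₃ ⟶ Q₁⟦(1 : ℤ)⟧)
        (d : Q₁ ⟶ T.obj₁), c ≫ d⟦(1 : ℤ)⟧' = b ≫ T.mor₃ := by
      let e : Q₃⟦(-1 : ℤ)⟧⟦(1 : ℤ)⟧ ≅ Q₃ := shiftNegShift Q₃ 1
      obtain ⟨k, hk⟩ := sh.map_surjective (e.hom ≫ b ≫ T.mor₃)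
      obtain ⟨Q₁, hQ₁, c, d, hcd⟩ := ih₁ (hQ₃c.shift (-1)) k
      refine ⟨Q₁, hQ₁, e.inv ≫ c⟦(1 : ℤ)⟧', d, ?_⟩
      rw [Category.assoc, ← Functor.map_comp, hcd]
      exact (e.inv_comp_eq).2 hk
    -- enlarge `Q₁` so that the composition with `a` vanishes
    obtain ⟨Q₂, hQ₂, c', d', hcd', hac⟩ : ∃ (Q₂ : C) (_ : coprodClosure S Q₂)
        (c' : Q₃ ⟶ Q₂⟦(1 : ℤ)⟧) (d' : Q₂ ⟶ T.obj₁), c' ≫ d'⟦(1 : ℤ)⟧' = b ≫ T.mor₃ ∧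
        a ≫ c' = 0 := by
      let e : P⟦(-1 : ℤ)⟧⟦(1 : ℤ)⟧ ≅ P := shiftNegShift P 1
      obtain ⟨k, hk⟩ := sh.map_surjective (e.hom ≫ a ≫ c)
      obtain ⟨D, m, m', hD⟩ := distinguished_cocone_triangle k
      have hkd : k ≫ d = 0 := sh.map_injective (by
        rw [Functor.map_comp, hk, Category.assoc, Category.assoc, hcd, reassoc_of% hab,
          comp_distTriang_mor_zero₂₃ _ hT, comp_zero, comp_zero, Functor.map_zero])
      obtain ⟨d₂, hd₂⟩ : ∃ d₂ : D ⟶ T.obj₁, d = m ≫ d₂ := Triangle.yoneda_exact₂ _ hD d hkd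
      have hDc : IsCompactObj D := isTriangSub_compacts.ext₃ hD (hP.shift (-1))
        (hQ₁.isCompactObj hS)
      obtain ⟨Q₂, hQ₂, u, w, huw⟩ := ih₁ hDc d₂
      refine ⟨Q₂, hQ₂, c ≫ (m ≫ u)⟦(1 : ℤ)⟧', w, ?_, ?_⟩
      · rw [Category.assoc, ← Functor.map_comp, Category.assoc, huw, ← hd₂, hcd]
      · have hkm : k ≫ m = 0 := comp_distTriang_mor_zero₁₂ _ hD
        rw [← cancel_epi e.hom, ← reassoc_of% hk, ← Functor.map_comp,
          reassoc_of% hkm]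
        simp
    obtain ⟨Q, p, q, hQ⟩ := distinguished_cocone_triangle₂ c'
    obtain ⟨l, hl⟩ : ∃ l : P ⟶ Q, a = l ≫ q := Triangle.coyoneda_exact₃ _ hQ a hac
    obtain ⟨θ, -, hθ₃⟩ := exists_triangle_hom₂ hQ hT d' b hcd'
    obtain ⟨w, comm⟩ : ∃ w : Q ⟶ T.obj₂, q ≫ b = w ≫ T.mor₂ :=
      ⟨θ.hom₂, by rw [← hθ₃]; exact θ.comm₂⟩
    obtain ⟨r, hr⟩ := T.coyoneda_exact₂ hT (φ - l ≫ w) (by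
      rw [Preadditive.sub_comp, Category.assoc, ← comm, ← Category.assoc, ← hl, hab, sub_self])
    have : φ = l ≫ w + r ≫ T.mor₁ := by rw [← hr]; abel
    rw [this]
    exact FactorsFinitely.add ⟨Q, .ext hQ hQ₂ hQ₃, l, w, rfl⟩ ((ih₁ hP r).comp _)

end Compact

section Telescope

open scoped Classical ZeroObject

variable [HasCoproducts.{v} C]

/-- The coproduct of the objects of a sequence. -/
noncomputable def tele (L : ℕ → C) : C := ∐ fun k : ULift.{v} ℕ => L k.down

/-- The inclusions in the coproduct of a sequence. -/
noncomputable def teleι (L : ℕ → C) (n : ℕ) : L n ⟶ tele L :=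
  Sigma.ι (fun k : ULift.{v} ℕ => L k.down) ⟨n⟩

/-- The projections from the coproduct of a sequence. -/
noncomputable def teleπ (L : ℕ → C) (n : ℕ) : tele L ⟶ L n :=
  letI : DecidableEq (ULift.{v} ℕ) := fun _ _ => Classical.propDecidable _
  Sigma.π (fun k : ULift.{v} ℕ => L k.down) ⟨n⟩

lemma teleι_π (L : ℕ → C) (n : ℕ) : teleι L n ≫ teleπ L n = 𝟙 _ :=
  letI : DecidableEq (ULift.{v} ℕ) := fun _ _ => Classical.propDecidable _
  Sigma.ι_π_eq_id (fun k : ULift.{v} ℕ => L k.down) ⟨n⟩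

lemma teleι_π_of_ne (L : ℕ → C) {n m : ℕ} (h : n ≠ m) : teleι L n ≫ teleπ L m = 0 :=
  letI : DecidableEq (ULift.{v} ℕ) := fun _ _ => Classical.propDecidable _
  Sigma.ι_π_of_ne (fun k : ULift.{v} ℕ => L k.down) fun h' => h (congrArg ULift.down h')

lemma tele_hom_ext {L : ℕ → C} {X : C} {f g : tele L ⟶ X}
    (h : ∀ n, teleι L n ≫ f = teleι L n ≫ g) : f = g :=
  Sigma.hom_ext _ _ fun k => h k.down

lemma exists_tele_desc {L : ℕ → C} {X : C} (p : ∀ n, L n ⟶ X) :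
    ∃ f : tele L ⟶ X, ∀ n, teleι L n ≫ f = p n :=
  ⟨Sigma.desc fun k : ULift.{v} ℕ => p k.down, fun n =>
    Sigma.ι_desc (fun k : ULift.{v} ℕ => p k.down) ⟨n⟩⟩

lemma IsCompactObj.eq_zero_of_teleπ {L : ℕ → C} {P : C} (hP : IsCompactObj P) {g : P ⟶ tele L}
    (hg : ∀ n, g ≫ teleπ L n = 0) : g = 0 :=
  hP.eq_of_π fun k => hg k.down

lemma IsCompactObj.exists_tele_sum {L : ℕ → C} {P : C} (hP : IsCompactObj P) (g : P ⟶ tele L) :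
    ∃ s : Finset ℕ, g = ∑ n ∈ s, (g ≫ teleπ L n) ≫ teleι L n := by
  obtain ⟨s, hs⟩ := isCompactObj_iff.1 hP (fun k : ULift.{v} ℕ => L k.down) g
  refine ⟨s.map Equiv.ulift.toEmbedding, ?_⟩
  rw [Finset.sum_map]
  exact hs

/-- The shift endomorphism of the coproduct of the objects of a sequence. -/
noncomputable def teleShift {L : ℕ → C} (i : ∀ n, L n ⟶ L (n + 1)) : tele L ⟶ tele L :=
  (exists_tele_desc fun n => i n ≫ teleι L (n + 1)).choose

lemma ι_teleShift {L : ℕ → C} (i : ∀ n, L n ⟶ L (n + 1)) (n : ℕ) :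
    teleι L n ≫ teleShift i = i n ≫ teleι L (n + 1) :=
  (exists_tele_desc fun n => i n ≫ teleι L (n + 1)).choose_spec n

lemma teleShift_π_zero {L : ℕ → C} (i : ∀ n, L n ⟶ L (n + 1)) :
    teleShift i ≫ teleπ L 0 = 0 := by
  refine tele_hom_ext fun k => ?_
  rw [← Category.assoc, ι_teleShift, Category.assoc, teleι_π_of_ne _ k.succ_ne_zero, comp_zero,
    comp_zero]

lemma teleShift_π_succ {L : ℕ → C} (i : ∀ n, L n ⟶ L (n + 1)) (n : ℕ) :
    teleShift i ≫ teleπ L (n + 1) = teleπ L n ≫ i n := by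
  refine tele_hom_ext fun k => ?_
  rw [← Category.assoc, ι_teleShift, Category.assoc]
  by_cases hk : k = n
  · subst hk
    rw [teleι_π, ← Category.assoc, teleι_π, Category.comp_id, Category.id_comp]
  · rw [teleι_π_of_ne _ (by omega), ← Category.assoc, teleι_π_of_ne _ hk, comp_zero, zero_comp]

lemma IsCompactObj.eq_zero_of_comp_id_sub_teleShift {L : ℕ → C} (i : ∀ n, L n ⟶ L (n + 1))
    {P : C} (hP : IsCompactObj P) {g : P ⟶ tele L} (hg : g ≫ (𝟙 _ - teleShift i) = 0) :
    g = 0 := by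
  have hg' : g = g ≫ teleShift i := by
    rwa [Preadditive.comp_sub, Category.comp_id, sub_eq_zero] at hg
  refine hP.eq_zero_of_teleπ fun k => ?_
  induction k with
  | zero => rw [hg', Category.assoc, teleShift_π_zero, comp_zero]
  | succ n ih => rw [hg', Category.assoc, teleShift_π_succ, ← Category.assoc, ih, zero_comp]

lemma IsCompactObj.exists_factor_telescope {L : ℕ → C} (i : ∀ n, L n ⟶ L (n + 1)) {H : C}
    {q : tele L ⟶ H} {δ : H ⟶ (tele L)⟦(1 : ℤ)⟧}
    (hT : Triangle.mk (𝟙 _ - teleShift i) q δ ∈ distTriang C)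
    {P : C} (hP : IsCompactObj P) (g : P ⟶ H) :
    ∃ (N : ℕ) (x : P ⟶ L N), g = x ≫ teleι L N ≫ q := by
  have hq : ∀ n, teleι L n ≫ q = i n ≫ teleι L (n + 1) ≫ q := by
    intro n
    have h : (𝟙 _ - teleShift i) ≫ q = 0 := comp_distTriang_mor_zero₁₂ _ hT
    have h' := teleι L n ≫= h
    rw [Preadditive.sub_comp, Category.id_comp, Preadditive.comp_sub, ← Category.assoc _ _ q,
      ι_teleShift, comp_zero, sub_eq_zero, Category.assoc] at h'
    exact h'
  have mono : ∀ (n k : ℕ) (x : P ⟶ L n), ∃ y : P ⟶ L (n + k),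
      x ≫ teleι L n ≫ q = y ≫ teleι L (n + k) ≫ q := by
    intro n k x
    induction k with
    | zero => exact ⟨x, rfl⟩
    | succ k ih =>
      obtain ⟨y, hy⟩ := ih
      exact ⟨y ≫ i (n + k), by rw [hy, hq, Category.assoc]; rfl⟩
  have mono' : ∀ {n m : ℕ} (_ : n ≤ m) (x : P ⟶ L n), ∃ y : P ⟶ L m,
      x ≫ teleι L n ≫ q = y ≫ teleι L m ≫ q := by
    intro n m h x
    obtain ⟨k, rfl⟩ := Nat.exists_eq_add_of_le h
    exact mono n k x
  have hgδ : g ≫ δ = 0 := by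
    let e : P⟦(-1 : ℤ)⟧⟦(1 : ℤ)⟧ ≅ P := shiftNegShift P 1
    let F := CategoryTheory.shiftFunctor C (1 : ℤ)
    obtain ⟨k, hk⟩ := F.map_surjective (e.hom ≫ g ≫ δ)
    have hδ : δ ≫ (𝟙 _ - teleShift i)⟦(1 : ℤ)⟧' = 0 := comp_distTriang_mor_zero₃₁ _ hT
    have hk0 : k = 0 := (hP.shift (-1)).eq_zero_of_comp_id_sub_teleShift i
      (F.map_injective (by
        rw [Functor.map_comp, hk, Category.assoc, Category.assoc, hδ, comp_zero, comp_zero,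
          Functor.map_zero]))
    rw [← cancel_epi e.hom, ← hk, hk0, Functor.map_zero, comp_zero]
  obtain ⟨y, hy⟩ : ∃ y : P ⟶ tele L, g = y ≫ q := Triangle.coyoneda_exact₃ _ hT g hgδ
  obtain ⟨t, ht⟩ := hP.exists_tele_sum y
  have key : ∀ t : Finset ℕ, ∃ (N : ℕ) (x : P ⟶ L N),
      (∑ k ∈ t, (y ≫ teleπ L k) ≫ teleι L k) ≫ q =
        x ≫ teleι L N ≫ q := by
    intro t
    induction t using Finset.induction_on with
    | empty => exact ⟨0, 0, by simp⟩
    | insert k t hk ih =>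
      obtain ⟨N, x, hx⟩ := ih
      obtain ⟨x', hx'⟩ := mono' (le_max_left N k) x
      obtain ⟨x'', hx''⟩ := mono' (le_max_right N k) (y ≫ teleπ L k)
      refine ⟨max N k, x'' + x', ?_⟩
      rw [Finset.sum_insert hk, Preadditive.add_comp, hx, hx', Preadditive.add_comp, ← hx'',
        Category.assoc (y ≫ _)]
  obtain ⟨N, x, hx⟩ := key t
  exact ⟨N, x, by rw [hy, ← hx, ← ht]⟩

/-- Killing the morphisms from the objects `s j` to `U` which vanish in `X`. -/
lemma exists_kill {J : Type v} (s : J → C) {X : C} (U : Over X) :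
    ∃ (U' : Over X) (ι : U ⟶ U'), (∀ j (h : s j ⟶ U.left), h ≫ U.hom = 0 → h ≫ ι.left = 0) ∧
      ∀ S : Set C, (∀ j, bigClosure S ((s j)⟦(1 : ℤ)⟧)) → bigClosure S U.left →
        bigClosure S U'.left := by
  let α : Type v := Σ j, { h : s j ⟶ U.left // h ≫ U.hom = 0 }
  let t : α → C := fun a => s a.1
  let d : ∐ t ⟶ U.left := Sigma.desc fun a => a.2.1
  obtain ⟨U', ι, δ, hT⟩ := distinguished_cocone_triangle d
  have hd : d ≫ U.hom = 0 := Sigma.hom_ext _ _ fun a => by simpa [d] using a.2.2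
  obtain ⟨p, hp⟩ : ∃ p : U' ⟶ X, U.hom = ι ≫ p := Triangle.yoneda_exact₂ _ hT U.hom hd
  refine ⟨Over.mk p, Over.homMk ι hp.symm, fun j h hh => ?_, fun S hS hU => ?_⟩
  · have h1 : h = Sigma.ι t ⟨j, h, hh⟩ ≫ d := by simp [d]
    have h2 : d ≫ ι = 0 := comp_distTriang_mor_zero₁₂ _ hT
    change h ≫ ι = 0
    rw [h1, Category.assoc, h2, comp_zero]
  · exact bigClosure.ext (rot_of_distTriang _ hT) hU
      (.of_iso (PreservesCoproduct.iso (CategoryTheory.shiftFunctor C (1 : ℤ)) t).symm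
        (.coprod _ fun a => hS a.1))

/-- Approximation of an object by an object built from compact objects. -/
lemma exists_approx {J : Type v} (s : J → C) (hs : ∀ j, IsCompactObj (s j)) {S S' : Set C}
    (h₀ : ∀ j, bigClosure S (s j)) (h₁ : ∀ j, bigClosure S ((s j)⟦(1 : ℤ)⟧))
    (hS : ∀ X ∈ S, bigClosure S' X) (hS₁ : ∀ X ∈ S, bigClosure S' (X⟦(1 : ℤ)⟧)) (X : C) :
    ∃ (L : C) (f : L ⟶ X), bigClosure S' L ∧ CovBij (Set.range s) f := by
  choose next ι hι hnext using fun U : Over X => exists_kill s U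
  let t : (Σ j, (s j ⟶ X)) → C := fun a => s a.1
  let U : ℕ → Over X := fun n =>
    Nat.rec (Over.mk (Sigma.desc (f := t) fun a => a.2)) (fun _ V => next V) n
  have hU : ∀ n, bigClosure S (U n).left := by
    intro n
    induction n with
    | zero => exact .coprod t fun a => h₀ a.1
    | succ n ih => exact hnext (U n) S h₁ ih
  let L : ℕ → C := fun n => (U n).left
  let i : ∀ n, L n ⟶ L (n + 1) := fun n => (ι (U n)).left
  let p : ∀ n, L n ⟶ X := fun n => (U n).hom
  have hip : ∀ n, i n ≫ p (n + 1) = p n := fun n => Over.w (ι (U n))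
  obtain ⟨H, q, δ, hT⟩ := distinguished_cocone_triangle (𝟙 _ - teleShift i)
  have hK : bigClosure S (tele L) :=
    .coprod (fun k : ULift.{v} ℕ => L k.down) fun k => hU k.down
  have hH : bigClosure S' H :=
    bigClosure.ext (rot_of_distTriang _ hT) (hK.trans hS) (hK.shift 1 hS₁)
  obtain ⟨pp, hpp⟩ := exists_tele_desc p
  obtain ⟨f, hf⟩ : ∃ f : H ⟶ X, pp = q ≫ f := by
    refine Triangle.yoneda_exact₂ _ hT pp ?_
    change (𝟙 (tele L) - teleShift i) ≫ pp = 0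
    refine tele_hom_ext fun n => ?_
    rw [Preadditive.sub_comp, Preadditive.comp_sub, Category.id_comp, ← Category.assoc,
      ι_teleShift, Category.assoc, hpp, hpp, hip, sub_self, comp_zero]
  refine ⟨H, f, hH, ?_⟩
  rintro _ ⟨j, rfl⟩
  constructor
  · intro g hg
    obtain ⟨N, x, rfl⟩ := (hs j).exists_factor_telescope i hT g
    have hx : x ≫ p N = 0 := by
      rw [← hpp, hf]
      simpa only [Category.assoc] using hg
    have hx' : x ≫ i N = 0 := hι (U N) j x hx
    have h : (𝟙 _ - teleShift i) ≫ q = 0 := comp_distTriang_mor_zero₁₂ _ hT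
    rw [Preadditive.sub_comp, Category.id_comp, sub_eq_zero] at h
    rw [h, ← Category.assoc (teleι _ _), ι_teleShift, Category.assoc, ← Category.assoc x, hx',
      zero_comp]
  · intro g
    refine ⟨(Sigma.ι t ⟨j, g⟩ : s j ⟶ L 0) ≫ teleι L 0 ≫ q, ?_⟩
    rw [Category.assoc, Category.assoc, ← hf, hpp]
    exact Sigma.ι_desc _ _

end Telescope

section Orthogonal

variable [HasCoproducts.{v} C]

/-- Composition of two shifts. -/
def shiftAddIso (X : C) {a b c : ℤ} (h : a + b = c) : X⟦a⟧⟦b⟧ ≅ X⟦c⟧ :=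
  ((shiftFunctorAdd' C a b c h).app X).symm

/-- The objects receiving no nonzero morphisms from `Σ^{-i}G`, `i ≥ n`. -/
def VSet (G : C) (n : ℤ) : Set C := {X | ∀ i ≥ n, HomZero (G⟦-i⟧) X}

/-- The left orthogonal of `VSet G n`. -/
def RSet (G : C) (n : ℤ) : Set C := lOrth (VSet G n)

lemma shift_mem_shiftSet {G : C} {I I' : Set ℤ} {X : C} (hX : X ∈ shiftSet G I) (k : ℤ)
    (h : ∀ i ∈ I, i - k ∈ I') : X⟦k⟧ ∈ shiftSet G I' := by
  obtain ⟨i, hi, ⟨e⟩⟩ := hX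
  exact ⟨i - k, h i hi, ⟨(CategoryTheory.shiftFunctor C k).mapIso e ≪≫
    shiftAddIso G (by ring)⟩⟩

lemma shiftClosed_shiftSet (G : C) : ShiftClosed (shiftSet G Set.univ) :=
  fun _ hX n => shift_mem_shiftSet hX n fun _ _ => trivial

lemma shiftSet_subset_compacts {G : C} (hG : IsCompactObj G) (I : Set ℤ) :
    shiftSet G I ⊆ compacts := by
  rintro X ⟨i, -, ⟨e⟩⟩
  exact isTriangSub_compacts.isoClosed e.symm (hG.shift (-i))

lemma shift_mem_shiftSet' {G : C} {I : Set ℤ} {i : ℤ} (hi : i ∈ I) : G⟦-i⟧ ∈ shiftSet G I :=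
  ⟨i, hi, ⟨Iso.refl _⟩⟩

lemma coprodClosure.homZero_left {S : Set C} {Y : C}
    (h : ∀ X ∈ S, HomZero X Y) {X : C} (hX : coprodClosure S X) : HomZero X Y := by
  induction hX with
  | of hX => exact h _ hX
  | zero hX => exact .of_isZero_left hX
  | ext hT _ _ h₁ h₃ => exact .ext_left hT h₁ h₃

lemma rOrth_genInt (G : C) (n : ℤ) : rOrth (genInt G (Set.Ici n)) = VSet G n := by
  ext X
  constructor
  · intro h i hi
    exact h ⟨_, .of (shift_mem_shiftSet' hi), 𝟙 _, 𝟙 _, by simp⟩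
  · rintro h A ⟨B, hB, i, r, hir⟩
    refine HomZero.of_retract_left i r hir (coprodClosure.homZero_left ?_ hB)
    rintro Y ⟨j, hj, ⟨e⟩⟩
    exact (h j hj).of_iso_left e

lemma VSet_mono (G : C) {n m : ℤ} (h : n ≤ m) : VSet G n ⊆ VSet G m :=
  fun _ hX i hi => hX i (h.trans hi)

lemma VSet_shift {G : C} {n m k : ℤ} {X : C} (hX : X ∈ VSet G n) (h : n - k ≤ m) :
    X⟦k⟧ ∈ VSet G m := fun i hi =>
  HomZero.shift_right k ((hX (i + k) (by have : m ≤ i := hi; show n ≤ i + k; omega)).of_iso_left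
    (shiftAddIso G (by ring)))

lemma RSet_anti (G : C) {n m : ℤ} (h : n ≤ m) : RSet G m ⊆ RSet G n :=
  fun _ hX _ hA => hX (VSet_mono G h hA)

lemma RSet_shift {G : C} {n m k : ℤ} {X : C} (hX : X ∈ RSet G n) (h : m ≤ n - k) :
    X⟦k⟧ ∈ RSet G m := fun _ hA =>
  HomZero.shift_left k (hX (VSet_shift hA (by omega)))

lemma CovBij.of_iso {S S' : Set C} {X Y : C} {f : X ⟶ Y} (hf : CovBij S f)
    (h : ∀ a ∈ S', ∃ a' ∈ S, Nonempty (a ≅ a')) : CovBij S' f := by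
  intro a ha
  obtain ⟨a', ha', ⟨e⟩⟩ := h a ha
  refine ⟨fun g hg => ?_, fun g => ?_⟩
  · rw [← cancel_epi e.inv, (hf a' ha').1 (e.inv ≫ g) (by rw [Category.assoc, hg, comp_zero]),
      comp_zero]
  · obtain ⟨k, hk⟩ := (hf a' ha').2 (e.inv ≫ g)
    exact ⟨e.hom ≫ k, by rw [Category.assoc, hk, e.hom_inv_id_assoc]⟩

lemma exists_approx_shift {G : C} (hG : IsCompactObj G) {I I' : Set ℤ}
    (h : ∀ i ∈ I, i ∈ I' ∧ i - 1 ∈ I' ∧ i - 2 ∈ I') (X : C) :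
    ∃ (L : C) (f : L ⟶ X), bigClosure (shiftSet G I') L ∧ CovBij (shiftSet G I) f := by
  let s : ULift.{v} I → C := fun i => G⟦-(i.down : ℤ)⟧
  let K : Set ℤ := {k | k ∈ I ∨ k + 1 ∈ I}
  have hK : ∀ k ∈ K, k ∈ I' ∧ k - 1 ∈ I' := by
    rintro k (hk | hk)
    · exact ⟨(h k hk).1, (h k hk).2.1⟩
    · have := h _ hk
      refine ⟨by simpa using this.2.1, by convert this.2.2 using 1; ring⟩
  have hs : ∀ i, s i ∈ shiftSet G I := fun i => shift_mem_shiftSet' i.down.2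
  obtain ⟨L, f, hL, hf⟩ := exists_approx s (fun i => hG.shift _) (S := shiftSet G K)
    (S' := shiftSet G I') (fun i => .of (shift_mem_shiftSet' (Or.inl i.down.2)))
    (fun i => .of (shift_mem_shiftSet (hs i) 1 fun j hj => Or.inr (by simpa using hj)))
    (fun Y ⟨i, hi, e⟩ => .of ⟨i, (hK i hi).1, e⟩)
    (fun Y hY => .of (shift_mem_shiftSet hY 1 fun j hj => (hK j hj).2)) X
  refine ⟨L, f, hL, hf.of_iso ?_⟩
  rintro a ⟨i, hi, e⟩
  exact ⟨_, ⟨⟨⟨i, hi⟩⟩, rfl⟩, e⟩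

lemma homZero_cone {T : Triangle C} (hT : T ∈ distTriang C) {a : C}
    (hi : ∀ g : a⟦(-1 : ℤ)⟧ ⟶ T.obj₁, g ≫ T.mor₁ = 0 → g = 0)
    (hs : ∀ g : a ⟶ T.obj₂, ∃ h : a ⟶ T.obj₁, h ≫ T.mor₁ = g) : HomZero a T.obj₃ := by
  intro g
  have hz : g ≫ T.mor₃ = 0 := by
    let e : a⟦(-1 : ℤ)⟧⟦(1 : ℤ)⟧ ≅ a := shiftNegShift a 1
    let F := CategoryTheory.shiftFunctor C (1 : ℤ)
    obtain ⟨k, hk⟩ := F.map_surjective (e.hom ≫ g ≫ T.mor₃)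
    have hk0 : k = 0 := hi k (F.map_injective (by
      rw [Functor.map_comp, hk, Category.assoc, Category.assoc,
        comp_distTriang_mor_zero₃₁ _ hT, comp_zero, comp_zero, Functor.map_zero]))
    rw [← cancel_epi e.hom, ← hk, hk0, Functor.map_zero, comp_zero]
  obtain ⟨k, rfl⟩ := T.coyoneda_exact₃ hT g hz
  obtain ⟨l, rfl⟩ := hs k
  rw [Category.assoc, comp_distTriang_mor_zero₁₂ _ hT, comp_zero]

lemma IsSingleCompactGenerator.isZero {G : C} (hG : IsSingleCompactGenerator G) {X : C}
    (h : X ∈ rOrth (shiftSet G Set.univ)) : IsZero X :=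
  hG.generates X fun n => h (A := G⟦n⟧) ⟨-n, trivial, ⟨(eqToIso (by simp))⟩⟩

lemma IsSingleCompactGenerator.isIso {G : C} (hG : IsSingleCompactGenerator G) {X Y : C}
    {f : X ⟶ Y} (h : CovBij (shiftSet G Set.univ) f) : IsIso f := by
  obtain ⟨Z, g, δ, hT⟩ := distinguished_cocone_triangle f
  exact (Triangle.isZero₃_iff_isIso₁ _ hT).1
    (hG.isZero (CovBij.rOrth_of_distTriang (shiftClosed_shiftSet G) hT h))

/-- Compact objects are summands of finite extensions of shifts of the generator. -/
lemma IsSingleCompactGenerator.exists_retract {G : C} (hG : IsSingleCompactGenerator G) {P : C}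
    (hP : IsCompactObj P) : ∃ (Q : C) (_ : coprodClosure (shiftSet G Set.univ) Q) (i : P ⟶ Q)
      (r : Q ⟶ P), i ≫ r = 𝟙 P := by
  obtain ⟨L, f, hL, hf⟩ := exists_approx_shift hG.compact (I := Set.univ) (I' := Set.univ)
    (fun _ _ => ⟨trivial, trivial, trivial⟩) P
  have := hG.isIso hf
  exact (hL.of_iso (asIso f)).factorsFinitely (shiftSet_subset_compacts hG.compact _) hP (𝟙 P)

/-- Compact objects are bounded with respect to the generator. -/
lemma IsSingleCompactGenerator.exists_bound {G : C} (hG : IsSingleCompactGenerator G) {P : C}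
    (hP : IsCompactObj P) :
    ∃ b : ℤ, ∀ (n : ℤ) (X : C), X ∈ VSet G n → ∀ i ≥ n + b, HomZero (P⟦-i⟧) X := by
  obtain ⟨Q, hQ, i, r, hir⟩ := hG.exists_retract hP
  suffices h : ∃ b : ℤ, ∀ (n : ℤ) (X : C), X ∈ VSet G n → ∀ i ≥ n + b, HomZero (Q⟦-i⟧) X by
    obtain ⟨b, hb⟩ := h
    refine ⟨b, fun n X hX k hk => (hb n X hX k hk).of_retract_left (i⟦-k⟧') (r⟦-k⟧') ?_⟩
    rw [← CategoryTheory.Functor.map_comp, hir, CategoryTheory.Functor.map_id]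
  clear hir
  clear i r
  induction hQ with
  | of hX =>
    obtain ⟨j, -, ⟨e⟩⟩ := hX
    refine ⟨-j, fun n X hX i hi => (hX (i + j) ?_).of_iso_left
      ((CategoryTheory.shiftFunctor C (-i)).mapIso e ≪≫ shiftAddIso G (by ring))⟩
    have : n + -j ≤ i := hi
    show n ≤ i + j
    omega
  | zero hX =>
    exact ⟨0, fun n X _ i _ =>
      .of_isZero_left ((CategoryTheory.shiftFunctor C (-i)).map_isZero hX)⟩
  | ext hT _ _ h₁ h₃ =>
    obtain ⟨b₁, h₁⟩ := h₁
    obtain ⟨b₃, h₃⟩ := h₃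
    refine ⟨max b₁ b₃, fun n X hX i hi => ?_⟩
    have hi : n + max b₁ b₃ ≤ i := hi
    exact HomZero.ext_left (Triangle.shift_distinguished _ hT (-i))
      (h₁ n X hX i (by show n + b₁ ≤ i; omega)) (h₃ n X hX i (by show n + b₃ ≤ i; omega))

lemma exists_retract_of_mem_RSet {G : C} (hG : IsCompactObj G) {m : ℤ} {R : C}
    (hR : R ∈ RSet G m) : ∃ (U : C) (_ : bigClosure (shiftSet G (Set.Ici (m - 2))) U)
      (i : R ⟶ U) (r : U ⟶ R), i ≫ r = 𝟙 R := by
  obtain ⟨U, f, hU, hf⟩ := exists_approx_shift hG (I := Set.Ici m) (I' := Set.Ici (m - 2))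
    (fun i hi => by simp only [Set.mem_Ici] at *; omega) R
  obtain ⟨Z, g, δ, hT⟩ := distinguished_cocone_triangle f
  have hZ : Z ∈ VSet G m := fun i hi => by
    have h₁ : (G⟦-i⟧)⟦(-1 : ℤ)⟧ ∈ shiftSet G (Set.Ici m) :=
      ⟨i + 1, (by have : m ≤ i := hi; show m ≤ i + 1; omega), ⟨shiftAddIso G (by ring)⟩⟩
    exact homZero_cone hT (hf _ h₁).1
      (hf _ (shift_mem_shiftSet' (show i ∈ Set.Ici m from hi))).2
  obtain ⟨i, hi⟩ := Triangle.coyoneda_exact₂ _ hT (𝟙 R) (hR hZ _)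
  exact ⟨U, hU, i, f, hi.symm⟩

lemma exists_homZero_generator {G : C} (hG : IsCompactObj G)
    (hvanish : ∃ N : ℕ, ∀ n : ℤ, n ≤ -(N : ℤ) → ∀ f : G ⟶ G⟦n⟧, f = 0) :
    ∃ M : ℤ, ∀ m ≥ M, ∀ R ∈ RSet G m, HomZero G R := by
  obtain ⟨N, hN⟩ := hvanish
  refine ⟨N + 2, fun m hm R hR => ?_⟩
  obtain ⟨U, hU, i, r, hir⟩ := exists_retract_of_mem_RSet hG hR
  refine HomZero.of_retract_right i r hir (bigClosure.homZero_right hG ?_ hU)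
  rintro X ⟨j, hj, ⟨e⟩⟩
  refine HomZero.of_iso_right e (hN (-j) ?_)
  simp only [Set.mem_Ici] at hj
  omega

lemma IsSingleCompactGenerator.exists_homZero {G : C} (hG : IsSingleCompactGenerator G)
    (hvanish : ∃ N : ℕ, ∀ n : ℤ, n ≤ -(N : ℤ) → ∀ f : G ⟶ G⟦n⟧, f = 0) {P : C}
    (hP : IsCompactObj P) : ∃ M : ℤ, ∀ m ≥ M, ∀ R ∈ RSet G m, HomZero P R := by
  obtain ⟨M₀, hM₀⟩ := exists_homZero_generator hG.compact hvanish
  obtain ⟨Q, hQ, i, r, hir⟩ := hG.exists_retract hP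
  suffices h : ∃ M : ℤ, ∀ m ≥ M, ∀ R ∈ RSet G m, HomZero Q R by
    obtain ⟨M, hM⟩ := h
    exact ⟨M, fun m hm R hR => (hM m hm R hR).of_retract_left i r hir⟩
  clear hir
  clear i r
  induction hQ with
  | of hX =>
    obtain ⟨j, -, ⟨e⟩⟩ := hX
    refine ⟨M₀ + j, fun m hm R hR => HomZero.of_iso_left e (HomZero.shift_left (-j)
      (hM₀ (m - j) ?_ _ (RSet_shift hR (by omega))))⟩
    have : M₀ + j ≤ m := hm
    show M₀ ≤ m - j
    omega
  | zero hX => exact ⟨0, fun m _ R _ => .of_isZero_left hX⟩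
  | ext hT _ _ h₁ h₃ =>
    obtain ⟨b₁, h₁⟩ := h₁
    obtain ⟨b₃, h₃⟩ := h₃
    exact ⟨max b₁ b₃, fun m hm R hR => HomZero.ext_left hT
      (h₁ m (le_trans (le_max_left _ _) hm) R hR) (h₃ m (le_trans (le_max_right _ _) hm) R hR)⟩

/-- The closure of the compacts is stable under extensions. -/
lemma IsSingleCompactGenerator.closureCompacts_ext {G : C} (hG : IsSingleCompactGenerator G)
    (hvanish : ∃ N : ℕ, ∀ n : ℤ, n ≤ -(N : ℤ) → ∀ f : G ⟶ G⟦n⟧, f = 0) {T : Triangle C}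
    (hT : T ∈ distTriang C) (h₁ : T.obj₁ ∈ closureCompacts (RSet G))
    (h₃ : T.obj₃ ∈ closureCompacts (RSet G)) : T.obj₂ ∈ closureCompacts (RSet G) := by
  intro n
  obtain ⟨Q, S, hQ, hS, q, s, δ₃, hT₃⟩ := h₃ n
  obtain ⟨M, hM⟩ := hG.exists_homZero hvanish hQ
  obtain ⟨P, R, hP, hR, p, r, δ₁, hT₁⟩ := h₁ (max (M + 1) n)
  have hR1 : R⟦(1 : ℤ)⟧ ∈ RSet G M := RSet_shift hR (by omega)
  obtain ⟨c, hc⟩ : ∃ c : Q ⟶ P⟦(1 : ℤ)⟧, c ≫ p⟦(1 : ℤ)⟧' = q ≫ T.mor₃ := by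
    obtain ⟨l, hl⟩ : ∃ l : Q ⟶ P⟦(1 : ℤ)⟧, q ≫ T.mor₃ = l ≫ (-p⟦(1 : ℤ)⟧') :=
      Triangle.coyoneda_exact₃ _ (rot_of_distTriang _ (rot_of_distTriang _ hT₁)) (q ≫ T.mor₃)
        (hM M le_rfl _ hR1 _)
    exact ⟨-l, by simp [hl]⟩
  obtain ⟨W, a, b, hW⟩ := distinguished_cocone_triangle₂ c
  obtain ⟨θ, hθ₁, hθ₃⟩ := exists_triangle_hom₂ hW hT p q hc
  obtain ⟨D, d, δ, hD⟩ := distinguished_cocone_triangle θ.hom₂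
  refine ⟨W, D, isTriangSub_compacts.ext _ hW hP hQ, fun V hV => ?_, θ.hom₂, d, δ, hD⟩
  have hRV : HomZero R V := RSet_anti G (le_max_right _ _) hR hV
  have i₁ : ContraInj θ.hom₁ V := hθ₁ ▸ contraInj_of_distTriang hT₁ hRV
  have i₃ : ContraInj θ.hom₃ V := hθ₃ ▸ contraInj_of_distTriang hT₃ (hS hV)
  have s₁ : ContraSurj (θ.hom₁⟦(1 : ℤ)⟧') V := hθ₁ ▸ contraSurj_shift_of_distTriang hT₁ hRV
  have s₃ : ContraSurj (θ.hom₃⟦(1 : ℤ)⟧') V := hθ₃ ▸ contraSurj_shift_of_distTriang hT₃ (hS hV)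
  exact homZero_of_distTriang hD (ContraInj.hom₂ hW hT θ i₁ i₃ s₁)
    (ContraSurj.shift_hom₂ hW hT θ i₃ s₁ s₃)

/-- The category `T^b_c`. -/
def TbcSet (G : C) : Set C := closureCompacts (RSet G) ∩ ⋃ n : ℤ, VSet G n

open ZeroObject in
lemma IsSingleCompactGenerator.isTriangSub_TbcSet {G : C} (hG : IsSingleCompactGenerator G)
    (hvanish : ∃ N : ℕ, ∀ n : ℤ, n ≤ -(N : ℤ) → ∀ f : G ⟶ G⟦n⟧, f = 0) :
    IsTriangSub (TbcSet G) := by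
  have zero : ∀ X : C, IsZero X → X ∈ TbcSet G := fun X hX =>
    ⟨fun n => ⟨X, X, .of_isZero hX, fun _ _ => HomZero.of_isZero_left hX, 𝟙 X, 0, 0,
      isomorphic_distinguished _ (contractible_distinguished X) _
        (Triangle.isoMk _ _ (Iso.refl _) (Iso.refl _) (hX.iso (isZero_zero C)) (hX.eq_of_src _ _)
          (hX.eq_of_src _ _) (hX.eq_of_src _ _))⟩,
      Set.mem_iUnion.2 ⟨0, fun _ _ => HomZero.of_isZero_right hX⟩⟩
  have ext : ∀ T ∈ distTriang C, T.obj₁ ∈ TbcSet G → T.obj₃ ∈ TbcSet G →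
      T.obj₂ ∈ TbcSet G := by
    rintro T hT ⟨h₁, h₁'⟩ ⟨h₃, h₃'⟩
    refine ⟨hG.closureCompacts_ext hvanish hT h₁ h₃, ?_⟩
    obtain ⟨n, hn⟩ := Set.mem_iUnion.1 h₁'
    obtain ⟨m, hm⟩ := Set.mem_iUnion.1 h₃'
    exact Set.mem_iUnion.2 ⟨max n m, fun i hi => HomZero.ext_right hT
      (hn i (le_trans (le_max_left _ _) hi)) (hm i (le_trans (le_max_right _ _) hi))⟩
  refine ⟨zero, fun {X Y} e hX => ?_, ?_, ext⟩
  · exact ext (Triangle.mk e.hom (0 : Y ⟶ 0) 0)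
      ((Triangle.distinguished_iff_of_isZero₃ _ (isZero_zero C)).2 (inferInstanceAs (IsIso e.hom)))
      hX (zero _ (isZero_zero C))
  · rintro X ⟨h, h'⟩ k
    obtain ⟨n, hn⟩ := Set.mem_iUnion.1 h'
    refine ⟨fun m => ?_, Set.mem_iUnion.2 ⟨n - k, VSet_shift hn le_rfl⟩⟩
    obtain ⟨P, R, hP, hR, p, r, δ, hT⟩ := h (m + k)
    exact ⟨P⟦k⟧, R⟦k⟧, hP.shift k, RSet_shift hR (by omega), _, _, _,
      Triangle.shift_distinguished _ hT k⟩

end Orthogonal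

section Decomposition

lemma CovBij.comp {S : Set C} {X Y Z : C} {f : X ⟶ Y} {g : Y ⟶ Z} (hf : CovBij S f)
    (hg : CovBij S g) : CovBij S (f ≫ g) := fun a ha =>
  ⟨fun k hk => (hf a ha).1 k ((hg a ha).1 _ (by rw [Category.assoc, hk])), fun k => by
    obtain ⟨l, rfl⟩ := (hg a ha).2 k
    obtain ⟨m, rfl⟩ := (hf a ha).2 l
    exact ⟨m, (Category.assoc _ _ _).symm⟩⟩

lemma covBij_of_isIso (S : Set C) {X Y : C} (f : X ⟶ Y) [IsIso f] : CovBij S f := fun _ _ =>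
  ⟨fun k hk => by rw [← cancel_mono f, hk, zero_comp], fun k => ⟨k ≫ inv f, by simp⟩⟩

/-- Approximations of the outer terms of a triangle induce one of the middle term. -/
lemma CovBij.exists_ext {S : Set C} (hS : ShiftClosed S) {T : Triangle C}
    (hT : T ∈ distTriang C) {X₁ X₃ : C} {u₁ : X₁ ⟶ T.obj₁} {u₃ : X₃ ⟶ T.obj₃}
    (h₁ : CovBij S u₁) (h₃ : CovBij S u₃)
    (hc : ∃ c : X₃ ⟶ X₁⟦(1 : ℤ)⟧, c ≫ u₁⟦(1 : ℤ)⟧' = u₃ ≫ T.mor₃) :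
    ∃ (X₂ : C) (a : X₁ ⟶ X₂) (b : X₂ ⟶ X₃) (c : X₃ ⟶ X₁⟦(1 : ℤ)⟧) (u₂ : X₂ ⟶ T.obj₂),
      Triangle.mk a b c ∈ distTriang C ∧ CovBij S u₂ := by
  obtain ⟨c, hc⟩ := hc
  obtain ⟨W, a, b, hW⟩ := distinguished_cocone_triangle₂ c
  obtain ⟨θ, hθ₁, hθ₃⟩ := exists_triangle_hom₂ hW hT u₁ u₃ hc
  exact ⟨W, a, b, c, θ.hom₂, hW, CovBij.hom₂ hS hW hT θ (by rw [hθ₁]; exact h₁)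
    (by rw [hθ₃]; exact h₃)⟩

/-- Objects generated by a triangulated subcategory `A` and its right orthogonal have right
`A`-approximations. -/
lemma IsTriangSub.exists_covBij {A B : Set C} (hA : IsTriangSub A) (hB : B ⊆ rOrth A) {Y : C}
    (hY : triangClosure (B ∪ A) Y) : ∃ (X : C) (_ : X ∈ A) (u : X ⟶ Y), CovBij A u := by
  induction hY with
  | of hY =>
    rcases hY with hY | hY
    · obtain ⟨Z, hZ⟩ := HasZeroObject.zero (C := C)
      exact ⟨Z, hA.zero _ hZ, 0, covBij_zero_of_isZero hZ (hB hY)⟩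
    · exact ⟨_, hY, 𝟙 _, covBij_id _ _⟩
  | zero hY => exact ⟨_, hA.zero _ hY, 𝟙 _, covBij_id _ _⟩
  | shift n _ ih =>
    obtain ⟨X, hX, u, hu⟩ := ih
    exact ⟨X⟦n⟧, hA.shift _ hX n, u⟦n⟧', hu.shift hA.shiftClosed n⟩
  | ext hT _ _ ih₁ ih₃ =>
    obtain ⟨X₁, hX₁, u₁, hu₁⟩ := ih₁
    obtain ⟨X₃, hX₃, u₃, hu₃⟩ := ih₃
    obtain ⟨W, a, b, c, w, hW, hw⟩ := CovBij.exists_ext hA.shiftClosed hT hu₁ hu₃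
      ((hu₁.shift hA.shiftClosed 1 _ hX₃).2 _)
    exact ⟨W, hA.ext _ hW hX₁ hX₃, w, hw⟩

/-- Objects generated by a triangulated subcategory `A` and objects left orthogonal to `D ⊇ A`
have left `A`-approximations relative to `D`. -/
lemma IsTriangSub.exists_contraBij {A B D : Set C} (hA : IsTriangSub A) (hD : ShiftClosed D)
    (hAD : A ⊆ D) (hB : B ⊆ lOrth D) {Y : C} (hY : triangClosure (A ∪ B) Y) :
    ∃ (X : C) (_ : X ∈ A) (u : Y ⟶ X), ContraBij D u := by
  induction hY with
  | of hY =>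
    rcases hY with hY | hY
    · exact ⟨_, hY, 𝟙 _, contraBij_id _ _⟩
    · obtain ⟨Z, hZ⟩ := HasZeroObject.zero (C := C)
      exact ⟨Z, hA.zero _ hZ, 0, contraBij_zero_of_isZero hZ (hB hY)⟩
  | zero hY => exact ⟨_, hA.zero _ hY, 𝟙 _, contraBij_id _ _⟩
  | shift n _ ih =>
    obtain ⟨X, hX, u, hu⟩ := ih
    exact ⟨X⟦n⟧, hA.shift _ hX n, u⟦n⟧', hu.shift hD n⟩
  | ext hT _ _ ih₁ ih₃ =>
    obtain ⟨X₁, hX₁, u₁, hu₁⟩ := ih₁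
    obtain ⟨X₃, hX₃, u₃, hu₃⟩ := ih₃
    obtain ⟨c, hc⟩ := (hu₃ _ (hAD (hA.shift _ hX₁ 1))).2 (Triangle.mor₃ _ ≫ u₁⟦(1 : ℤ)⟧')
    obtain ⟨W, a, b, hW⟩ := distinguished_cocone_triangle₂ c
    obtain ⟨θ, hθ₁, hθ₃⟩ := exists_triangle_hom₂ hT hW u₁ u₃ hc.symm
    exact ⟨W, hA.ext _ hW hX₁ hX₃, θ.hom₂, ContraBij.hom₂ hD hT hW θ (by rw [hθ₁]; exact hu₁)
      (by rw [hθ₃]; exact hu₃)⟩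

/-- A pair of triangulated subcategories for which every object sits in a decomposition triangle
is a semiorthogonal decomposition. -/
lemma isSOD_of_exists_triangle {D A B : Set C} (hD : IsTriangSub D) (hA : IsTriangSub A)
    (hB : IsTriangSub B) (hAD : A ⊆ D) (hBD : B ⊆ D) (h : ∀ b ∈ B, ∀ a ∈ A, HomZero b a)
    (hT : ∀ X ∈ D, ∃ (b a : C) (_ : b ∈ B) (_ : a ∈ A) (f : b ⟶ X) (g : X ⟶ a)
      (δ : a ⟶ b⟦(1 : ℤ)⟧), Triangle.mk f g δ ∈ distTriang C) : IsSOD D A B where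
  subsetA := hAD
  subsetB := hBD
  triangA := hA
  triangB := hB
  hom_zero := h
  generates := by
    ext X
    refine ⟨hD.triangClosure_subset (Set.union_subset hAD hBD), fun hX => ?_⟩
    obtain ⟨b, a, hb, ha, f, g, δ, hT⟩ := hT X hX
    exact triangClosure.ext (T := Triangle.mk f g δ) hT (.of (Or.inr hb)) (.of (Or.inl ha))

variable [HasCoproducts.{v} C]

lemma subset_CoprodSet (A : Set C) : A ⊆ CoprodSet A := fun _ hX => .of hX

lemma bigClosure_shiftSet_subset {A : Set C} (hA : IsTriangSub A) {H : C} (hH : H ∈ A)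
    {I : Set ℤ} {X : C} (hX : bigClosure (shiftSet H I) X) : bigClosure A X := by
  refine bigClosure.trans (S := shiftSet H I) ?_ hX
  rintro Y ⟨i, -, ⟨e⟩⟩
  exact .of (hA.isoClosed e.symm (hA.shift _ hH _))

namespace IsSOD

variable {A B : Set C}

lemma subset_rOrth {D : Set C} (h : IsSOD D A B) : A ⊆ rOrth B := fun a ha b hb =>
  h.hom_zero b hb a ha

lemma CoprodSet_subset_rOrth (h : IsSOD compacts A B) : CoprodSet A ⊆ rOrth B :=
  fun _ hX _ hb => bigClosure.homZero_right (h.subsetB hb) (fun a ha => h.hom_zero _ hb a ha) hX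

/-- The left projection of the generator to `A`. -/
lemma exists_contraBij (h : IsSOD compacts A B) {G : C} (hG : IsCompactObj G) :
    ∃ (H : C) (_ : H ∈ A) (u : G ⟶ H), ContraBij (rOrth B) u :=
  h.triangA.exists_contraBij h.triangB.shiftClosed.rOrth h.subset_rOrth
    (fun _ hb _ hX => hX hb) (h.generates.ge hG)

lemma exists_covBij (h : IsSOD compacts A B) {P : C} (hP : IsCompactObj P) :
    ∃ (X : C) (_ : X ∈ B) (u : X ⟶ P), CovBij B u :=
  h.triangB.exists_covBij h.subset_rOrth (h.generates.ge hP)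

end IsSOD

lemma ContraBij.homZero_shift {D : Set C} (hD : ShiftClosed D) {X Y : C} {u : X ⟶ Y}
    (hu : ContraBij D u) {d : C} (hd : d ∈ D) (n : ℤ) (h : HomZero (Y⟦n⟧) d) :
    HomZero (X⟦n⟧) d := fun g => by
  obtain ⟨k, rfl⟩ := (hu.shift hD n d hd).2 g
  rw [h k, comp_zero]

namespace IsSingleCompactGenerator

variable {G : C} {A B : Set C}

/-- The right orthogonal of `B` is generated by the projection of the generator. -/
lemma bigClosure_of_mem_rOrth (hG : IsSingleCompactGenerator G) (h : IsSOD compacts A B) {H : C}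
    (hH : H ∈ A) {u : G ⟶ H} (hu : ContraBij (rOrth B) u) {Y : C} (hY : Y ∈ rOrth B) :
    bigClosure (shiftSet H Set.univ) Y := by
  obtain ⟨L, f, hL, hf⟩ := exists_approx_shift (h.subsetA hH) (I := Set.univ) (I' := Set.univ)
    (fun _ _ => ⟨trivial, trivial, trivial⟩) Y
  obtain ⟨Z, g, δ, hT⟩ := distinguished_cocone_triangle f
  have hB := h.triangB.shiftClosed
  have hLB : L ∈ rOrth B := h.CoprodSet_subset_rOrth (bigClosure_shiftSet_subset h.triangA hH hL)
  have hZB : Z ∈ rOrth B := hB.isTriangSub_rOrth.ext₃ hT hLB hY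
  have hZ : Z ∈ rOrth (shiftSet H Set.univ) :=
    CovBij.rOrth_of_distTriang (shiftClosed_shiftSet H) hT hf
  have hZ₀ : IsZero Z := by
    refine hG.isZero ?_
    rintro X ⟨i, -, ⟨e⟩⟩
    exact HomZero.of_iso_left e (hu.homZero_shift hB.rOrth hZB _
      (hZ (shift_mem_shiftSet' (Set.mem_univ i))))
  have : IsIso f := (Triangle.isZero₃_iff_isIso₁ _ hT).1 hZ₀
  exact hL.of_iso (asIso f)

lemma rOrth_eq_CoprodSet (hG : IsSingleCompactGenerator G) (h : IsSOD compacts A B) :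
    rOrth B = CoprodSet A := by
  obtain ⟨H, hH, u, hu⟩ := h.exists_contraBij hG.compact
  exact Set.Subset.antisymm (fun Y hY => bigClosure_shiftSet_subset h.triangA hH
    (hG.bigClosure_of_mem_rOrth h hH hu hY)) h.CoprodSet_subset_rOrth

lemma exists_covBij (hG : IsSingleCompactGenerator G) (h : IsSOD compacts A B) (X : C) :
    ∃ (L : C) (_ : L ∈ CoprodSet A) (f : L ⟶ X), CovBij A f := by
  obtain ⟨H, hH, u, hu⟩ := h.exists_contraBij hG.compact
  obtain ⟨L, f, hL, hf⟩ := exists_approx_shift (h.subsetA hH) (I := Set.univ) (I' := Set.univ)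
    (fun _ _ => ⟨trivial, trivial, trivial⟩) X
  refine ⟨L, bigClosure_shiftSet_subset h.triangA hH hL, f, fun a ha => ?_⟩
  exact hf.coprodSet (shiftClosed_shiftSet H) a
    (hG.bigClosure_of_mem_rOrth h hH hu (h.subset_rOrth ha))

/-- The right projection to `CoprodSet A` preserves boundedness. -/
lemma exists_mem_VSet (hG : IsSingleCompactGenerator G) (h : IsSOD compacts A B) {n : ℤ}
    {L X : C} (hL : L ∈ CoprodSet A) {f : L ⟶ X} (hf : CovBij A f) (hX : X ∈ VSet G n) :
    ∃ m, L ∈ VSet G m := by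
  obtain ⟨H, hH, u, hu⟩ := h.exists_contraBij hG.compact
  obtain ⟨b, hb⟩ := hG.exists_bound (h.subsetA hH)
  refine ⟨n + b, fun i hi => hu.homZero_shift h.triangB.shiftClosed.rOrth
    (h.CoprodSet_subset_rOrth hL) _ fun g => ?_⟩
  exact (hf _ (h.triangA.shift _ hH _)).1 g (hb n X hX i hi _)

/-- The right projections of highly connected objects are highly connected. -/
lemma exists_covBij_RSet (hG : IsSingleCompactGenerator G) (h : IsSOD compacts B A) (n : ℤ) :
    ∃ p : ℤ, ∀ U : C, bigClosure (shiftSet G (Set.Ici p)) U →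
      ∃ (D : C) (_ : D ∈ CoprodSet A) (_ : D ∈ RSet G n) (f : D ⟶ U), CovBij A f := by
  obtain ⟨K, hK, u, hu⟩ := h.exists_covBij hG.compact
  obtain ⟨b, hb⟩ := hG.exists_bound (h.subsetB hK)
  have hA := h.triangB.shiftClosed
  refine ⟨n + b, fun U hU => ?_⟩
  induction hU with
  | of hU =>
    obtain ⟨i, hi, ⟨e⟩⟩ := hU
    exact ⟨K⟦-i⟧, .of (h.triangB.shift _ hK _), fun V hV => hb n V hV i hi,
      u⟦-i⟧' ≫ e.inv, (hu.shift hA _).comp (covBij_of_isIso _ _)⟩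
  | zero hU => exact ⟨_, .zero hU, fun _ _ => HomZero.of_isZero_left hU, 𝟙 _, covBij_id _ _⟩
  | coprod X _ ih =>
    choose D hD hD' f hf using ih
    exact ⟨∐ D, .coprod D hD, fun V hV => HomZero.coprod_left fun i => hD' i hV,
      Limits.Sigma.map f, CovBij.sigmaMap h.subsetB hf⟩
  | ext hT _ _ ih₁ ih₃ =>
    obtain ⟨X₁, hX₁, hX₁', u₁, hu₁⟩ := ih₁
    obtain ⟨X₃, hX₃, hX₃', u₃, hu₃⟩ := ih₃
    obtain ⟨W, a, b, c, w, hW, hw⟩ := CovBij.exists_ext hA hT hu₁ hu₃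
      (((hu₁.shift hA 1).coprodSet hA _ hX₃).2 _)
    exact ⟨W, bigClosure.ext (T := Triangle.mk a b c) hW hX₁ hX₃,
      mem_lOrth_of_distTriang (T := Triangle.mk a b c) hW hX₁' hX₃', w, hw⟩

lemma mem_RSet_of_covBij {U R D D' : C} {n : ℤ} (hA : ShiftClosed A) {i : R ⟶ U} {r : U ⟶ R}
    (hir : i ≫ r = 𝟙 R) (hD : D ∈ CoprodSet A) {f : D ⟶ R} (hf : CovBij A f)
    (hD' : D' ∈ CoprodSet A) {f' : D' ⟶ U} (hf' : CovBij A f') (h : D' ∈ RSet G n) :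
    D ∈ RSet G n := by
  obtain ⟨α, hα⟩ := (hf'.coprodSet hA _ hD).2 (f ≫ i)
  obtain ⟨β, hβ⟩ := (hf.coprodSet hA _ hD').2 (f' ≫ r)
  refine fun V hV => HomZero.of_retract_left α β (sub_eq_zero.1 ?_) (h hV)
  refine (hf.coprodSet hA _ hD).1 _ ?_
  rw [Preadditive.sub_comp, Category.assoc, hβ, ← Category.assoc, hα, Category.assoc, hir,
    Category.comp_id, Category.id_comp, sub_self]

/-- The right projection to `CoprodSet A` preserves the closure of the compacts. -/
lemma mem_closureCompacts (hG : IsSingleCompactGenerator G) (h : IsSOD compacts B A)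
    {L X : C} (hL : L ∈ CoprodSet A) {f : L ⟶ X} (hf : CovBij A f)
    (hX : X ∈ closureCompacts (RSet G)) : L ∈ closureCompacts (RSet G) := by
  intro n
  have hA := h.triangB.shiftClosed
  obtain ⟨p, hp⟩ := hG.exists_covBij_RSet h n
  obtain ⟨P, R, hP, hR, x, q, δ, hT⟩ := hX (p + 2)
  obtain ⟨U, hU, i, r, hir⟩ := exists_retract_of_mem_RSet hG.compact hR
  rw [add_sub_cancel_right] at hU
  obtain ⟨D', hD', hD'n, f', hf'⟩ := hp U hU
  obtain ⟨K, hK, u, hu⟩ := h.exists_covBij hP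
  obtain ⟨c, hc⟩ := (hf K hK).2 (u ≫ x)
  obtain ⟨D, g, δ', hT'⟩ := distinguished_cocone_triangle c
  obtain ⟨φ, hφ₁, hφ₂⟩ := exists_triangle_hom hT' hT u f hc
  have hφ : CovBij A φ.hom₃ := CovBij.hom₃ hA hT' hT φ (by rw [hφ₁]; exact hu)
    (by rw [hφ₂]; exact hf)
  have hD : D ∈ CoprodSet A :=
    (CoprodSet.isTriangSub hA).ext₃ hT' (subset_CoprodSet A hK) hL
  exact ⟨K, D, h.subsetB hK, mem_RSet_of_covBij hA hir hD hφ hD' hf' hD'n, c, g, δ', hT'⟩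

/-- Decomposition triangles in `TbcSet G`. -/
lemma exists_triangle_TbcSet (hG : IsSingleCompactGenerator G)
    (hvanish : ∃ N : ℕ, ∀ n : ℤ, n ≤ -(N : ℤ) → ∀ f : G ⟶ G⟦n⟧, f = 0) {A' : Set C}
    (h : IsSOD compacts A B) (h' : IsSOD compacts A' A) {X : C} (hX : X ∈ TbcSet G) :
    ∃ (L Y : C) (_ : L ∈ CoprodSet A ∩ TbcSet G) (_ : Y ∈ rOrth A ∩ TbcSet G) (f : L ⟶ X)
      (g : X ⟶ Y) (δ : Y ⟶ L⟦(1 : ℤ)⟧), Triangle.mk f g δ ∈ distTriang C := by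
  obtain ⟨L, hL, f, hf⟩ := hG.exists_covBij h X
  obtain ⟨Y, g, δ, hT⟩ := distinguished_cocone_triangle f
  have hLT : L ∈ TbcSet G := by
    refine ⟨hG.mem_closureCompacts h' hL hf hX.1, ?_⟩
    obtain ⟨n, hn⟩ := Set.mem_iUnion.1 hX.2
    exact Set.mem_iUnion.2 (hG.exists_mem_VSet h hL hf hn)
  exact ⟨L, Y, ⟨hL, hLT⟩, ⟨CovBij.rOrth_of_distTriang h.triangA.shiftClosed hT hf,
    (hG.isTriangSub_TbcSet hvanish).ext₃ hT hLT hX⟩, f, g, δ, hT⟩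

end IsSingleCompactGenerator

end Decomposition

end Paper

namespace Paper

variable {C : Type u} [Category.{v} C] [HasZeroObject C] [Preadditive C]
  [HasShift C ℤ] [∀ n : ℤ, (CategoryTheory.shiftFunctor C n).Additive] [Pretriangulated C]
  [HasCoproducts.{v} C]

/-- Let `T` be compactly generated with a single compact generator `G` such that
`Hom(G, ΣⁿG) = 0` for all `n ≪ 0`, equipped with the generating sequence `𝒢ⁿ = {ΣⁿG}`
(so `M^𝒢_n = ⟨G⟩^{[n,∞)}` and `R^𝒢_n = ^⊥((M^𝒢_n)^⊥)`). For every admissible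
subcategory `A` of `T^c`, the subcategory `Coprod(A) ∩ T^b_c` is a right admissible
subcategory of `T^b_c = T̄^c ∩ 𝒢^⊥`. In particular, for a semiorthogonal decomposition
`⟨A,B⟩` of `T^c` with `B` admissible, `⟨Coprod(A) ∩ T^b_c, Coprod(B) ∩ T^b_c⟩` is a
semiorthogonal decomposition of `T^b_c`. -/
theorem statement_12 (G : C) (hG : IsSingleCompactGenerator G)
    (hvanish : ∃ N : ℕ, ∀ n : ℤ, n ≤ -(N : ℤ) → ∀ f : G ⟶ G⟦n⟧, f = 0)
    (Tbc : Set C)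
    (hTbc : Tbc =
      closureCompacts (fun n => lOrth (rOrth (genInt G (Set.Ici n)))) ∩
        ⋃ n : ℤ, rOrth (genInt G (Set.Ici n))) :
    -- right admissibility of `Coprod(A) ∩ T^b_c` for every admissible `A ⊆ T^c`
    (∀ A : Set C,
      IsSOD (compacts (C := C)) (rOrth A ∩ compacts) A →
      IsSOD (compacts (C := C)) A (lOrth A ∩ compacts) →
      IsSOD Tbc (rOrth (CoprodSet A ∩ Tbc) ∩ Tbc) (CoprodSet A ∩ Tbc)) ∧
    -- in particular, the induced semiorthogonal decomposition of `T^b_c`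
    (∀ A B : Set C, IsSOD (compacts (C := C)) A B →
      IsSOD (compacts (C := C)) (rOrth B ∩ compacts) B →
      IsSOD (compacts (C := C)) B (lOrth B ∩ compacts) →
      IsSOD Tbc (CoprodSet A ∩ Tbc) (CoprodSet B ∩ Tbc)) := by
  obtain rfl : Tbc = TbcSet G := by
    simp only [hTbc, rOrth_genInt]
    rfl
  clear hTbc
  have hT := hG.isTriangSub_TbcSet hvanish
  constructor
  · intro A h' h
    have hA := CoprodSet.isTriangSub h.triangA.shiftClosed
    have hAT := hA.inter hT
    refine isSOD_of_exists_triangle hT (hAT.shiftClosed.isTriangSub_rOrth.inter hT) hAT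
      Set.inter_subset_right Set.inter_subset_right (fun b hb a ha => ha.1 hb) fun X hX => ?_
    obtain ⟨L, Y, hL, hY, f, g, δ, hfg⟩ := hG.exists_triangle_TbcSet hvanish h h' hX
    refine ⟨L, Y, hL, ⟨?_, hY.2⟩, f, g, δ, hfg⟩
    have hYA : Y ∈ rOrth (CoprodSet A) := by
      rw [rOrth_CoprodSet]
      exact hY.1
    exact fun _ hZ => hYA hZ.1
  · intro A B hAB h' h
    refine isSOD_of_exists_triangle hT
      ((CoprodSet.isTriangSub hAB.triangA.shiftClosed).inter hT)
      ((CoprodSet.isTriangSub hAB.triangB.shiftClosed).inter hT)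
      Set.inter_subset_right Set.inter_subset_right ?_ fun X hX => ?_
    · intro b hb a ha
      exact bigClosure.homZero_left (fun b hb => hAB.CoprodSet_subset_rOrth ha.1 hb) hb.1
    · obtain ⟨L, Y, hL, hY, f, g, δ, hfg⟩ := hG.exists_triangle_TbcSet hvanish h h' hX
      rw [hG.rOrth_eq_CoprodSet hAB] at hY
      exact ⟨L, Y, hL, hY, f, g, δ, hfg⟩

end Paper
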